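/- arXiv:2603.12742 — 2 statements merged into one kernel-verified Lean document; each statement's English description precedes it below -/
import Mathlib

section
/- There exist universal constants γ > 0 and C_K > 0 with the following property: for every continuously differentiable, ℤ²-periodic, divergence-free vector field u : ℝ² → ℝ² whose vorticity ω := rot u is bounded, and for every β > 0 satisfying β·‖ω‖_{L^∞(T²)} ≤ γ, one has ∫_{[0,1]²} exp(β·|∇u(x)|) dx ≤ C_K. -/
open MeasureTheory

noncomputable section

abbrev V2 : Type := Fin 2 → ℝ

/-- The unit square `[0,1]²`, a fundamental domain of the torus `T²`. -/
def box : Set V2 := Set.Icc 0 1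

/-- Partial derivative `∂ᵢ f` of a scalar field. -/
def pd (i : Fin 2) (f : V2 → ℝ) (x : V2) : ℝ := fderiv ℝ f x (Pi.single i 1)

/-- Laplacian of a scalar field. -/
def lap (f : V2 → ℝ) (x : V2) : ℝ := pd 0 (pd 0 f) x + pd 1 (pd 1 f) x

/-- `ℤ²`-periodicity of a scalar field. -/
def PeriodicS (f : V2 → ℝ) : Prop :=
  ∀ (x : V2) (k : Fin 2 → ℤ), f (x + fun i => (k i : ℝ)) = f x

/-- `ℤ²`-periodicity of a vector field. -/
def PeriodicV (u : V2 → V2) : Prop :=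
  ∀ (x : V2) (k : Fin 2 → ℤ), u (x + fun i => (k i : ℝ)) = u x

/-- Divergence `∂₁u₁ + ∂₂u₂`. -/
def div2 (u : V2 → V2) (x : V2) : ℝ :=
  pd 0 (fun y => u y 0) x + pd 1 (fun y => u y 1) x

/-- Vorticity `rot u = ∂₁u₂ − ∂₂u₁`. -/
def rot2 (u : V2 → V2) (x : V2) : ℝ :=
  pd 0 (fun y => u y 1) x - pd 1 (fun y => u y 0) x

/-- Frobenius norm `|∇u|` of the Jacobian of a vector field. -/
def gradV (u : V2 → V2) (x : V2) : ℝ :=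
  Real.sqrt (∑ i : Fin 2, ∑ j : Fin 2, (pd j (fun y => u y i) x) ^ 2)

/-- Euclidean norm `|∇f|` of the gradient of a scalar field. -/
def gradS (f : V2 → ℝ) (x : V2) : ℝ :=
  Real.sqrt ((pd 0 f x) ^ 2 + (pd 1 f x) ^ 2)

/-- `L^p(T²)` norm (`p` finite) of a scalar field. -/
def lpNorm (p : ℝ) (f : V2 → ℝ) : ℝ :=
  (∫ x in box, |f x| ^ p) ^ (1 / p)

/-- `L^∞(T²)` norm of a (continuous) scalar field. -/
def linf (f : V2 → ℝ) : ℝ := ⨆ x ∈ box, |f x|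

/-- `L²(T²)` norm of a vector field (Euclidean norm on values). -/
def l2V (u : V2 → V2) : ℝ := Real.sqrt (∫ x in box, ((u x 0) ^ 2 + (u x 1) ^ 2))

/-- Smoothness of a time-dependent scalar field, jointly in `(t,x)`. -/
def SmoothTS (f : ℝ → V2 → ℝ) : Prop :=
  ContDiff ℝ (⊤ : ℕ∞) (fun q : ℝ × V2 => f q.1 q.2)

/-- Smoothness of a time-dependent vector field, jointly in `(t,x)`. -/
def SmoothTV (u : ℝ → V2 → V2) : Prop :=
  ContDiff ℝ (⊤ : ℕ∞) (fun q : ℝ × V2 => u q.1 q.2)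

section

open Complex Set

/-- The `n`-th Fourier coefficient of `φ` on `(-π, π]`. -/
def circleCoeff (φ : ℝ → ℂ) (n : ℤ) : ℂ :=
  (2 * Real.pi : ℝ)⁻¹ • ∫ θ in (-Real.pi)..Real.pi, exp (-(n * θ * I)) * φ θ

lemma circleCoeff_eq_fourierCoeffOn (φ : ℝ → ℂ) (n : ℤ) (h : -Real.pi < Real.pi) :
    circleCoeff φ n = fourierCoeffOn h φ n := by
  rw [fourierCoeffOn_eq_integral, circleCoeff]
  have e : Real.pi - -Real.pi = 2 * Real.pi := by ring
  rw [e, one_div]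
  congr 1
  refine intervalIntegral.integral_congr fun θ _ => ?_
  simp only [smul_eq_mul]
  rw [fourier_coe_apply]
  congr 2
  have : (Real.pi : ℂ) ≠ 0 := by exact_mod_cast Real.pi_ne_zero
  push_cast
  field_simp

lemma hasSum_sq_circleCoeff {φ : ℝ → ℂ} (hφ : Continuous φ) :
    HasSum (fun n => ‖circleCoeff φ n‖ ^ 2)
      ((2 * Real.pi)⁻¹ * ∫ θ in (-Real.pi)..Real.pi, ‖φ θ‖ ^ 2) := by
  have h : -Real.pi < Real.pi := by linarith [Real.pi_pos]
  obtain ⟨M, hM⟩ := isCompact_Icc.exists_bound_of_continuousOn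
    (hφ.continuousOn (s := Icc (-Real.pi) Real.pi))
  have hm : MemLp φ 2 (volume.restrict (Ioc (-Real.pi) Real.pi)) :=
    MemLp.of_bound hφ.aestronglyMeasurable M ((ae_restrict_iff' measurableSet_Ioc).2
      (Filter.Eventually.of_forall fun θ hθ => hM θ (Ioc_subset_Icc_self hθ)))
  have := hasSum_sq_fourierCoeffOn h hm
  rw [show Real.pi - -Real.pi = 2 * Real.pi by ring] at this
  simpa only [circleCoeff_eq_fourierCoeffOn _ _ h, smul_eq_mul] using this

lemma norm_circleCoeff_le {φ : ℝ → ℂ} {M : ℝ} (h : ∀ θ, ‖φ θ‖ ≤ M) (n : ℤ) :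
    ‖circleCoeff φ n‖ ≤ M := by
  have h1 : ‖∫ θ in (-Real.pi)..Real.pi, exp (-(n * θ * I)) * φ θ‖
      ≤ M * |Real.pi - -Real.pi| := by
    refine intervalIntegral.norm_integral_le_of_norm_le_const fun θ _ => ?_
    rw [norm_mul, show -((n : ℂ) * θ * I) = ((-(n * θ) : ℝ) : ℂ) * I by push_cast; ring,
      norm_exp_ofReal_mul_I, one_mul]
    exact h θ
  have hp := Real.pi_pos
  rw [show Real.pi - -Real.pi = 2 * Real.pi by ring, abs_of_pos (by positivity)] at h1
  rw [circleCoeff, norm_smul, Real.norm_of_nonneg (by positivity), inv_mul_le_iff₀ (by positivity)]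
  linarith

lemma circleCoeff_add {φ ψ : ℝ → ℂ} (hφ : Continuous φ) (hψ : Continuous ψ) (n : ℤ) :
    circleCoeff (fun θ => φ θ + ψ θ) n = circleCoeff φ n + circleCoeff ψ n := by
  simp only [circleCoeff, mul_add]
  rw [intervalIntegral.integral_add, smul_add] <;>
  exact Continuous.intervalIntegrable (by fun_prop) _ _

lemma circleCoeff_const_mul (c : ℂ) (φ : ℝ → ℂ) (n : ℤ) :
    circleCoeff (fun θ => c * φ θ) n = c * circleCoeff φ n := by
  simp only [circleCoeff, mul_left_comm _ c, intervalIntegral.integral_const_mul, mul_smul_comm]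

lemma circleCoeff_exp_mul_I (n : ℤ) :
    circleCoeff (fun θ => exp (θ * I)) n = if n = 1 then 1 else 0 := by
  have hp : (Real.pi : ℂ) ≠ 0 := by exact_mod_cast Real.pi_ne_zero
  have e : ∀ θ : ℝ, exp (-(n * θ * I)) * exp (θ * I) = exp (((1 - n : ℤ) * I) * θ) := by
    intro θ; rw [← exp_add]; congr 1; push_cast; ring
  simp only [circleCoeff, e]
  split_ifs with h
  · subst h
    simp
    field_simp
    norm_num
  · have hn : ((1 - n : ℤ) : ℂ) * I ≠ 0 :=
      mul_ne_zero (by exact_mod_cast sub_ne_zero.2 (Ne.symm h)) I_ne_zero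
    rw [integral_exp_mul_complex hn]
    have : exp (((1 - n : ℤ) * I) * (Real.pi : ℝ))
        = exp (((1 - n : ℤ) * I) * ((-Real.pi : ℝ) : ℂ)) := by
      rw [exp_eq_exp_iff_exists_int]
      exact ⟨1 - n, by push_cast; ring⟩
    rw [this]; simp

lemma continuous_circleCoeff {X : Type*} [TopologicalSpace X] [FirstCountableTopology X]
    {φ : X → ℝ → ℂ} (hφ : Continuous (Function.uncurry φ)) (n : ℤ) :
    Continuous fun x => circleCoeff (φ x) n := by
  unfold circleCoeff
  refine Continuous.const_smul (M := ℝ) ?_ _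
  refine intervalIntegral.continuous_parametric_intervalIntegral_of_continuous' ?_ _ _
  have : Continuous fun p : X × ℝ => φ p.1 p.2 := hφ
  simp only [Function.uncurry_def]
  fun_prop

lemma circleCoeff_deriv {φ φ' : ℝ → ℂ} (h : ∀ θ, HasDerivAt φ (φ' θ) θ) (hc : Continuous φ')
    (hper : φ (-Real.pi) = φ Real.pi) (n : ℤ) :
    circleCoeff φ' n = n * I * circleCoeff φ n := by
  have hφ : Continuous φ := continuous_iff_continuousAt.2 fun θ => (h θ).continuousAt
  have hd : ∀ θ : ℝ, HasDerivAt (fun θ : ℝ => exp (-(n * θ * I)))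
      (-(n * I) * exp (-(n * θ * I))) θ := by
    intro θ
    have h1 : HasDerivAt (fun θ : ℝ => -((n : ℂ) * θ * I)) (-(n * 1 * I)) θ :=
      (((hasDerivAt_id θ).ofReal_comp).const_mul (n : ℂ) |>.mul_const I).neg
    convert h1.cexp using 1
    ring
  have hI := intervalIntegral.integral_mul_deriv_eq_deriv_mul
    (a := -Real.pi) (b := Real.pi) (fun x _ => hd x) (fun x _ => h x)
    (Continuous.intervalIntegrable (by fun_prop) _ _) (hc.intervalIntegrable _ _)
  have hexp : exp (-((n : ℂ) * (Real.pi : ℝ) * I))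
      = exp (-((n : ℂ) * ((-Real.pi : ℝ) : ℂ) * I)) := by
    rw [exp_eq_exp_iff_exists_int]
    exact ⟨-n, by push_cast; ring⟩
  rw [circleCoeff, circleCoeff, hI, hexp, hper, sub_self, zero_sub]
  simp only [mul_assoc, intervalIntegral.integral_const_mul]
  rw [neg_mul, neg_neg, real_smul, real_smul]
  ring

lemma hasDerivAt_circleCoeff {φ φ' : ℝ → ℝ → ℂ}
    (h : ∀ ρ θ, HasDerivAt (fun s => φ s θ) (φ' ρ θ) ρ)
    (hφ : Continuous (Function.uncurry φ)) (hφ' : Continuous (Function.uncurry φ'))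
    (n : ℤ) (ρ : ℝ) :
    HasDerivAt (fun s => circleCoeff (φ s) n) (circleCoeff (φ' ρ) n) ρ := by
  unfold circleCoeff
  refine HasDerivAt.const_smul (R := ℝ) _ ?_
  have c1 : Continuous fun p : ℝ × ℝ => φ p.1 p.2 := hφ
  have c2 : Continuous fun p : ℝ × ℝ => φ' p.1 p.2 := hφ'
  have hK : IsCompact (Icc (ρ - 1) (ρ + 1) ×ˢ Icc (-Real.pi) Real.pi) :=
    isCompact_Icc.prod isCompact_Icc
  obtain ⟨M, hM⟩ := hK.exists_bound_of_continuousOn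
    (f := fun p : ℝ × ℝ => exp (-(n * p.2 * I)) * φ' p.1 p.2)
    (by fun_prop)
  refine (intervalIntegral.hasDerivAt_integral_of_dominated_loc_of_deriv_le
    (F := fun s θ => exp (-(n * θ * I)) * φ s θ)
    (F' := fun s θ => exp (-(n * θ * I)) * φ' s θ) (bound := fun _ => M)
    (s := Icc (ρ - 1) (ρ + 1))
    (Icc_mem_nhds (by linarith) (by linarith)) ?_ ?_ ?_ ?_ ?_ ?_).2
  · exact Filter.Eventually.of_forall fun s => (by fun_prop : Continuous _).aestronglyMeasurable
  · exact Continuous.intervalIntegrable (by fun_prop) _ _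
  · exact (by fun_prop : Continuous _).aestronglyMeasurable
  · refine Filter.Eventually.of_forall fun θ hθ s hs => hM (s, θ) ⟨hs, ?_⟩
    rw [uIoc_of_le (by linarith [Real.pi_pos])] at hθ
    exact Ioc_subset_Icc_self hθ
  · exact intervalIntegrable_const
  · exact Filter.Eventually.of_forall fun θ _ s _ => (h s θ).const_mul _

lemma sq_mul_sq_le_of_inner {χ ρ S A m x y z P : ℝ} (hχ : 0 ≤ χ) (hχ1 : χ ≤ 1) (hρ : 0 ≤ ρ)
    (hS : 0 < S) (hy : 0 ≤ y) (hxy : |m| * y = ρ * x)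
    (hA : m < 0 ∨ y ≤ A) (hP : |P| ≤ x * z) :
    χ ^ 2 * (ρ * x ^ 2) ≤ (-(2 * χ * m * y ^ 2 / S) + 2 * χ ^ 2 * (ρ * (x ^ 2 + 2 * P)))
      + 2 * ρ * A ^ 2 / S ^ 2 + 8 * (ρ * z ^ 2) := by
  have h1 : 2 * χ * m * y ^ 2 / S ≤ χ ^ 2 * ρ * x ^ 2 / 2 + 2 * ρ * A ^ 2 / S ^ 2 := by
    rcases hA with hm | hA
    · have : 2 * χ * m * y ^ 2 / S ≤ 0 :=
        div_nonpos_of_nonpos_of_nonneg (by nlinarith [mul_nonneg hχ (sq_nonneg y)]) hS.le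
      have : 0 ≤ χ ^ 2 * ρ * x ^ 2 / 2 + 2 * ρ * A ^ 2 / S ^ 2 := by positivity
      linarith
    · have e1 : m * y ^ 2 ≤ ρ * x * y := by
        rw [← hxy]; nlinarith [le_abs_self m, sq_nonneg y]
      have e2 : 2 * χ * m * y ^ 2 / S ≤ 2 * χ * (ρ * x * y) / S := by
        gcongr ?_ / S
        nlinarith [mul_le_mul_of_nonneg_left e1 hχ]
      have e3 : ρ * (2 * χ * x * (y / S)) ≤ ρ * (χ ^ 2 * x ^ 2 / 2 + 2 * (y / S) ^ 2) := by
        gcongr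
        nlinarith [sq_nonneg (χ * x - 2 * (y / S))]
      have e4 : ρ * (2 * (y / S) ^ 2) ≤ 2 * ρ * A ^ 2 / S ^ 2 := by
        rw [div_pow, show ρ * (2 * (y ^ 2 / S ^ 2)) = 2 * ρ * y ^ 2 / S ^ 2 by ring]
        gcongr
      have e5 : 2 * χ * (ρ * x * y) / S = ρ * (2 * χ * x * (y / S)) := by ring
      linarith
  have h2 : -(4 * χ ^ 2 * ρ * P) ≤ χ ^ 2 * ρ * x ^ 2 / 2 + 8 * (ρ * z ^ 2) := by
    have e1 : -P ≤ x * z := (neg_le_abs P).trans hP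
    have e2 : χ ^ 2 * ρ * (-(4 * P)) ≤ χ ^ 2 * ρ * (x ^ 2 / 2 + 8 * z ^ 2) := by
      gcongr
      nlinarith [sq_nonneg (x - 4 * z)]
    have e3 : χ ^ 2 * (ρ * z ^ 2) ≤ 1 * (ρ * z ^ 2) := by
      gcongr
      nlinarith
    linarith
  linarith

/-- Weighted energy estimate for the radial equation `a' = m a / ρ + 2 g`, where `d = m a / ρ`. -/
lemma integral_sq_le_of_radial_ode {S A m : ℝ} (hS : 0 < S) (hm : m ≠ 0) {a d g : ℝ → ℂ}
    (hd : Continuous d) (hg : Continuous g) (ha : ∀ ρ, HasDerivAt a (d ρ + 2 * g ρ) ρ)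
    (had : ∀ ρ : ℝ, m * a ρ = ρ * d ρ) (hA : m < 0 ∨ ∀ ρ ∈ Icc 0 S, ‖a ρ‖ ≤ A) :
    ∫ ρ in 0..S, (1 - ρ / S) ^ 2 * (ρ * ‖d ρ‖ ^ 2)
      ≤ 8 * (∫ ρ in 0..S, ρ * ‖g ρ‖ ^ 2) + A ^ 2 := by
  have hac : Continuous a := continuous_iff_continuousAt.2 fun ρ => (ha ρ).continuousAt
  have ha0 : a 0 = 0 := by
    have := had 0
    simpa [hm] using this
  set ψ' : ℝ → ℝ := fun ρ => 2 * (1 - ρ / S) * (-(1 / S)) * ‖a ρ‖ ^ 2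
    + (1 - ρ / S) ^ 2 * (2 * inner ℝ (a ρ) (d ρ + 2 * g ρ)) with hψ'
  have hψ : ∀ ρ, HasDerivAt (fun ρ => (1 - ρ / S) ^ 2 * ‖a ρ‖ ^ 2) (ψ' ρ) ρ := by
    intro ρ
    have h1 : HasDerivAt (fun ρ : ℝ => 1 - ρ / S) (-(1 / S)) ρ :=
      ((hasDerivAt_id ρ).div_const S).const_sub 1
    have h2 := (h1.pow 2).mul (ha ρ).norm_sq
    refine h2.congr_deriv ?_
    simp [hψ']
  have hψc : Continuous ψ' := by
    simp only [hψ']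
    fun_prop
  have hint : ∫ ρ in 0..S, ψ' ρ = 0 := by
    rw [intervalIntegral.integral_eq_sub_of_hasDerivAt (fun ρ _ => hψ ρ)
      (hψc.intervalIntegrable _ _)]
    simp [ha0, hS.ne']
  have hpt : ∀ ρ ∈ Icc 0 S, (1 - ρ / S) ^ 2 * (ρ * ‖d ρ‖ ^ 2)
      ≤ m * ψ' ρ + (2 * A ^ 2 / S ^ 2) * ρ + 8 * (ρ * ‖g ρ‖ ^ 2) := by
    intro ρ hρ
    have hχ : 0 ≤ 1 - ρ / S := by
      rw [sub_nonneg, div_le_one hS]; exact hρ.2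
    have hχ1 : 1 - ρ / S ≤ 1 := by
      have : 0 ≤ ρ / S := div_nonneg hρ.1 hS.le
      linarith
    have hxy : |m| * ‖a ρ‖ = ρ * ‖d ρ‖ := by
      have := congrArg norm (had ρ)
      simpa [abs_of_nonneg hρ.1] using this
    have key := sq_mul_sq_le_of_inner (A := A) hχ hχ1 hρ.1 hS (norm_nonneg (a ρ)) hxy
      (hA.imp_right fun h => h ρ hρ) (abs_real_inner_le_norm (d ρ) (g ρ))
    have hin : m * inner ℝ (a ρ) (d ρ + 2 * g ρ) = ρ * (‖d ρ‖ ^ 2 + 2 * inner ℝ (d ρ) (g ρ)) := by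
      rw [← real_inner_smul_left, real_smul, had ρ, ← real_smul, real_inner_smul_left,
        inner_add_right, real_inner_self_eq_norm_sq,
        show (2 : ℂ) * g ρ = (2 : ℝ) • g ρ by simp, real_inner_smul_right]
    have e : m * ψ' ρ = -(2 * (1 - ρ / S) * m * ‖a ρ‖ ^ 2 / S)
        + 2 * (1 - ρ / S) ^ 2 * (ρ * (‖d ρ‖ ^ 2 + 2 * inner ℝ (d ρ) (g ρ))) := by
      rw [← hin]; simp only [hψ']; ring
    rw [e]
    refine key.trans (le_of_eq ?_)
    ring
  have hle : ∫ ρ in 0..S, (1 - ρ / S) ^ 2 * (ρ * ‖d ρ‖ ^ 2)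
      ≤ ∫ ρ in 0..S, (m * ψ' ρ + (2 * A ^ 2 / S ^ 2) * ρ + 8 * (ρ * ‖g ρ‖ ^ 2)) :=
    intervalIntegral.integral_mono_on hS.le
    (Continuous.intervalIntegrable (by fun_prop) _ _)
    (Continuous.intervalIntegrable (by fun_prop) _ _) hpt
  refine hle.trans (le_of_eq ?_)
  rw [intervalIntegral.integral_add (Continuous.intervalIntegrable (by fun_prop) _ _)
    (Continuous.intervalIntegrable (by fun_prop) _ _),
    intervalIntegral.integral_add (Continuous.intervalIntegrable (by fun_prop) _ _)
    (Continuous.intervalIntegrable (by fun_prop) _ _),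
    intervalIntegral.integral_const_mul, intervalIntegral.integral_const_mul,
    intervalIntegral.integral_const_mul, hint, integral_id]
  field_simp
  ring

/-- The unweighted form of `integral_sq_le_of_radial_ode`, on half of the interval. -/
lemma integral_sq_le_of_radial_ode_half {R A m : ℝ} (hR : 0 < R) (hm : m ≠ 0) {a d g : ℝ → ℂ}
    (hd : Continuous d) (hg : Continuous g) (ha : ∀ ρ, HasDerivAt a (d ρ + 2 * g ρ) ρ)
    (had : ∀ ρ : ℝ, m * a ρ = ρ * d ρ) (hA : m < 0 ∨ ∀ ρ ∈ Icc 0 (2 * R), ‖a ρ‖ ≤ A) :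
    ∫ ρ in 0..R, ρ * ‖d ρ‖ ^ 2
      ≤ 32 * (∫ ρ in 0..2 * R, ρ * ‖g ρ‖ ^ 2) + 4 * A ^ 2 := by
  have h := integral_sq_le_of_radial_ode (by positivity : 0 < 2 * R) hm hd hg ha had hA
  have h1 : ∫ ρ in 0..R, ρ * ‖d ρ‖ ^ 2
      ≤ ∫ ρ in 0..R, 4 * ((1 - ρ / (2 * R)) ^ 2 * (ρ * ‖d ρ‖ ^ 2)) := by
    refine intervalIntegral.integral_mono_on hR.le
      (Continuous.intervalIntegrable (by fun_prop) _ _)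
      (Continuous.intervalIntegrable (by fun_prop) _ _) fun ρ hρ => ?_
    have : 1 / 2 ≤ 1 - ρ / (2 * R) := by
      have : ρ / (2 * R) ≤ 1 / 2 := by
        rw [div_le_iff₀ (by positivity)]; linarith [hρ.2]
      linarith
    have h4 : 1 ≤ 4 * (1 - ρ / (2 * R)) ^ 2 := by nlinarith
    have : 0 ≤ ρ * ‖d ρ‖ ^ 2 := mul_nonneg hρ.1 (sq_nonneg _)
    nlinarith
  have h2 : ∫ ρ in 0..R, (1 - ρ / (2 * R)) ^ 2 * (ρ * ‖d ρ‖ ^ 2)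
      ≤ ∫ ρ in 0..2 * R, (1 - ρ / (2 * R)) ^ 2 * (ρ * ‖d ρ‖ ^ 2) := by
    refine intervalIntegral.integral_mono_interval le_rfl hR.le (by linarith) ?_
      (Continuous.intervalIntegrable (by fun_prop) _ _)
    refine (ae_restrict_iff' measurableSet_Ioc).2 (Filter.Eventually.of_forall fun ρ hρ => ?_)
    have := hρ.1
    simp only [Pi.zero_apply]
    positivity
  rw [intervalIntegral.integral_const_mul] at h1
  linarith

/-- A bounded solution of `a' = n a / ρ + 2 g` with `2 ≤ n` is controlled from infinity. -/
lemma norm_le_of_radial_ode_two_le {K M : ℝ} {k : ℕ} {a d g : ℝ → ℂ}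
    (ha : ∀ ρ, HasDerivAt a (d ρ + 2 * g ρ) ρ)
    (had : ∀ ρ : ℝ, ((k + 2 : ℕ) : ℂ) * a ρ = ρ * d ρ) (hK : ∀ ρ, ‖g ρ‖ ≤ K)
    (hM : ∀ ρ, ‖a ρ‖ ≤ M) {ρ : ℝ} (hρ : 0 < ρ) :
    ‖a ρ‖ ≤ 2 * K * ρ / (k + 1) := by
  have hK0 : 0 ≤ K := (norm_nonneg _).trans (hK 0)
  have hb : ∀ s : ℝ, 0 < s → HasDerivAt (fun s : ℝ => ((s⁻¹ ^ (k + 2) : ℝ) : ℂ) * a s)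
      (((s⁻¹ ^ (k + 2) : ℝ) : ℂ) * (2 * g s)) s := by
    intro s hs
    have h1 : HasDerivAt (fun s : ℝ => s⁻¹ ^ (k + 2))
        (((k + 2 : ℕ) : ℝ) * s⁻¹ ^ (k + 1) * (-(s ^ 2)⁻¹)) s :=
      (hasDerivAt_inv hs.ne').pow (k + 2)
    refine (h1.ofReal_comp.mul (ha s)).congr_deriv ?_
    have hs' : (s : ℂ) ≠ 0 := by exact_mod_cast hs.ne'
    have h2 : d s = (s : ℂ)⁻¹ * (((k + 2 : ℕ) : ℂ) * a s) := by
      rw [had s]; field_simp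
    rw [h2]
    push_cast
    simp only [inv_pow]
    field_simp
    ring
  have key : ∀ T, ρ ≤ T → ρ⁻¹ ^ (k + 2) * ‖a ρ‖ ≤ T⁻¹ ^ (k + 2) * M
      + 2 * K / (k + 1) * ρ⁻¹ ^ (k + 1) := by
    intro T hT
    have hT0 : 0 < T := hρ.trans_le hT
    set b : ℝ → ℂ := fun s : ℝ => ((s⁻¹ ^ (k + 2) : ℝ) : ℂ) * a s with hbdef
    have hbd := image_norm_le_of_norm_deriv_right_le_deriv_boundary'
      (f := fun s => b s - b ρ) (f' := fun s => ((s⁻¹ ^ (k + 2) : ℝ) : ℂ) * (2 * g s))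
      (a := ρ) (b := T) (B := fun s => 2 * K / (k + 1) * (ρ⁻¹ ^ (k + 1) - s⁻¹ ^ (k + 1)))
      (B' := fun s => 2 * K * s⁻¹ ^ (k + 2)) ?_ ?_ ?_ ?_ ?_ ?_ (right_mem_Icc.2 hT)
    · have e1 : ‖b ρ‖ = ρ⁻¹ ^ (k + 2) * ‖a ρ‖ := by
        simp [hbdef, abs_of_pos hρ]
      have e2 : ‖b T‖ ≤ T⁻¹ ^ (k + 2) * M := by
        simp only [hbdef, norm_mul, norm_real, Real.norm_eq_abs]
        rw [abs_of_pos (by positivity)]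
        gcongr
        exact hM T
      have e3 : ‖b ρ‖ ≤ ‖b T‖ + ‖b T - b ρ‖ := by
        rw [norm_sub_rev]
        exact norm_le_norm_add_norm_sub' _ _
      have e4 : 0 ≤ 2 * K / (k + 1) * T⁻¹ ^ (k + 1) := by positivity
      rw [← e1]
      linarith
    · intro s hs
      exact ((hb s (hρ.trans_le hs.1)).continuousAt.sub continuousAt_const).continuousWithinAt
    · intro s hs
      exact ((hb s (hρ.trans_le hs.1)).sub_const _).hasDerivWithinAt
    · simp
    · intro s hs
      have hs0 : s ≠ 0 := (hρ.trans_le hs.1).ne'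
      exact ((continuousAt_const.sub
        ((continuousAt_inv₀ hs0).pow _)).const_mul _).continuousWithinAt
    · intro s hs
      have hs0 : s ≠ 0 := (hρ.trans_le hs.1).ne'
      have h1 : HasDerivAt (fun s : ℝ => s⁻¹ ^ (k + 1))
          (((k + 1 : ℕ) : ℝ) * s⁻¹ ^ k * (-(s ^ 2)⁻¹)) s := (hasDerivAt_inv hs0).pow (k + 1)
      refine ((h1.const_sub _).const_mul _).hasDerivWithinAt.congr_deriv ?_
      push_cast
      simp only [inv_pow]
      field_simp
      ring
    · intro s hs
      have hs0 : 0 < s := hρ.trans_le hs.1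
      rw [norm_mul, norm_real, Real.norm_of_nonneg (by positivity), norm_mul, RCLike.norm_ofNat]
      have := hK s
      calc s⁻¹ ^ (k + 2) * (2 * ‖g s‖) ≤ s⁻¹ ^ (k + 2) * (2 * K) := by gcongr
        _ = _ := by ring
  have hlim : Filter.Tendsto (fun T : ℝ => T⁻¹ ^ (k + 2) * M + 2 * K / (k + 1) * ρ⁻¹ ^ (k + 1))
      Filter.atTop (nhds (0 ^ (k + 2) * M + 2 * K / (k + 1) * ρ⁻¹ ^ (k + 1))) :=
    ((tendsto_inv_atTop_zero.pow (k + 2)).mul_const M).add_const _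
  have h := ge_of_tendsto hlim (Filter.eventually_atTop.2 ⟨ρ, key⟩)
  rw [zero_pow (by omega), zero_mul, zero_add] at h
  have h3 : ρ⁻¹ ^ (k + 2) * ‖a ρ‖ ≤ ρ⁻¹ ^ (k + 2) * (2 * K * ρ / (k + 1)) := by
    refine h.trans (le_of_eq ?_)
    rw [pow_succ ρ⁻¹ (k + 1)]
    field_simp
  exact le_of_mul_le_mul_left h3 (by positivity)

/-- Solutions of `a' = a / ρ + 2 g` deviate from a linear function by at most `2 K S` on
`[0, S]`. -/
lemma norm_sub_le_of_radial_ode_one {K S : ℝ} {a d g : ℝ → ℂ}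
    (ha : ∀ ρ, HasDerivAt a (d ρ + 2 * g ρ) ρ)
    (had : ∀ ρ : ℝ, a ρ = ρ * d ρ) (hK : ∀ ρ, ‖g ρ‖ ≤ K) {ρ : ℝ} (hρ : ρ ∈ Icc 0 S) :
    ‖a ρ - ρ * d S‖ ≤ 2 * K * S := by
  have hK0 : 0 ≤ K := (norm_nonneg _).trans (hK 0)
  have hS : 0 ≤ S := hρ.1.trans hρ.2
  rcases hρ.1.eq_or_lt with h0 | h0
  · rw [← h0, had 0]
    simp
    positivity
  have hb : ∀ s : ℝ, 0 < s → HasDerivAt d ((s : ℂ)⁻¹ * (2 * g s)) s := by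
    intro s hs
    have hs' : (s : ℂ) ≠ 0 := by exact_mod_cast hs.ne'
    have h1 : HasDerivAt (fun s : ℝ => ((s⁻¹ : ℝ) : ℂ) * a s)
        (((-(s ^ 2)⁻¹ : ℝ) : ℂ) * a s + ((s⁻¹ : ℝ) : ℂ) * (d s + 2 * g s)) s :=
      (hasDerivAt_inv hs.ne').ofReal_comp.mul (ha s)
    have h2 : ((-(s ^ 2)⁻¹ : ℝ) : ℂ) * a s + ((s⁻¹ : ℝ) : ℂ) * (d s + 2 * g s)
        = (s : ℂ)⁻¹ * (2 * g s) := by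
      rw [had s]; push_cast; field_simp; ring
    rw [← h2]
    refine h1.congr_of_eventuallyEq ?_
    filter_upwards [lt_mem_nhds hs] with t ht
    have ht' : (t : ℂ) ≠ 0 := by exact_mod_cast ht.ne'
    rw [had t]; push_cast; field_simp
  have hmv := (convex_Icc ρ S).norm_image_sub_le_of_norm_hasDerivWithin_le
    (f := d) (C := 2 * K / ρ)
    (fun s hs => (hb s (h0.trans_le hs.1)).hasDerivWithinAt) (fun s hs => ?_)
    (right_mem_Icc.2 hρ.2) (left_mem_Icc.2 hρ.2)
  · rw [had ρ, ← mul_sub, norm_mul, norm_real, Real.norm_of_nonneg hρ.1]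
    rw [Real.norm_eq_abs, abs_sub_comm, abs_of_nonneg (by linarith [hρ.2])] at hmv
    calc ρ * ‖d ρ - d S‖ ≤ ρ * (2 * K / ρ * (S - ρ)) := by gcongr
      _ = 2 * K * (S - ρ) := by field_simp
      _ ≤ 2 * K * S := by gcongr; linarith
  · have hs0 : 0 < s := h0.trans_le hs.1
    rw [norm_mul, norm_inv, norm_real, Real.norm_of_nonneg hs0.le, norm_mul, RCLike.norm_ofNat,
      inv_mul_eq_div]
    have := hK s
    have := hs.1
    gcongr

lemma hasSum_integral_sq_circleCoeff {Φ : ℝ → ℝ → ℂ} (hΦ : Continuous (Function.uncurry Φ))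
    {R : ℝ} (hR : 0 ≤ R) :
    HasSum (fun n => ∫ ρ in 0..R, ρ * ‖circleCoeff (Φ ρ) n‖ ^ 2)
      (∫ ρ in 0..R, ρ * ((2 * Real.pi)⁻¹ * ∫ θ in (-Real.pi)..Real.pi, ‖Φ ρ θ‖ ^ 2)) := by
  have hc : Continuous fun p : ℝ × ℝ => Φ p.1 p.2 := hΦ
  have hcc : ∀ n, Continuous fun ρ => ρ * ‖circleCoeff (Φ ρ) n‖ ^ 2 := fun n => by
    have := continuous_circleCoeff hΦ n
    fun_prop
  have hct : Continuous fun ρ : ℝ =>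
      ρ * ((2 * Real.pi)⁻¹ * ∫ θ in (-Real.pi)..Real.pi, ‖Φ ρ θ‖ ^ 2) := by
    have : Continuous fun ρ : ℝ => ∫ θ in (-Real.pi)..Real.pi, ‖Φ ρ θ‖ ^ 2 := by
      refine intervalIntegral.continuous_parametric_intervalIntegral_of_continuous' ?_ _ _
      simp only [Function.uncurry_def]
      fun_prop
    fun_prop
  have hpar : ∀ ρ, HasSum (fun n => ρ * ‖circleCoeff (Φ ρ) n‖ ^ 2)
      (ρ * ((2 * Real.pi)⁻¹ * ∫ θ in (-Real.pi)..Real.pi, ‖Φ ρ θ‖ ^ 2)) := fun ρ =>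
    (hasSum_sq_circleCoeff (φ := Φ ρ) (by fun_prop)).mul_left ρ
  have hsum : Summable fun n => ∫ ρ in 0..R, ρ * ‖circleCoeff (Φ ρ) n‖ ^ 2 := by
    refine summable_of_sum_le (c := ∫ ρ in 0..R,
      ρ * ((2 * Real.pi)⁻¹ * ∫ θ in (-Real.pi)..Real.pi, ‖Φ ρ θ‖ ^ 2)) (fun n => ?_) fun s => ?_
    · exact intervalIntegral.integral_nonneg hR fun ρ hρ => mul_nonneg hρ.1 (sq_nonneg _)
    · rw [← intervalIntegral.integral_finsetSum fun n _ => (hcc n).intervalIntegrable _ _]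
      refine intervalIntegral.integral_mono_on hR ?_ (hct.intervalIntegrable _ _) fun ρ hρ => ?_
      · exact Continuous.intervalIntegrable (continuous_finsetSum _ fun n _ => hcc n) _ _
      · exact sum_le_hasSum s (fun n _ => mul_nonneg hρ.1 (sq_nonneg _)) (hpar ρ)
  have key := hasSum_integral_of_summable_integral_norm (μ := volume.restrict (Ioc 0 R))
    (F := fun n ρ => ρ * ‖circleCoeff (Φ ρ) n‖ ^ 2)
    (fun n => ((hcc n).intervalIntegrable 0 R).1) ?_
  · simp only [(hpar _).tsum_eq] at key
    simpa only [intervalIntegral.integral_of_le hR] using key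
  · convert hsum using 2 with n
    rw [intervalIntegral.integral_of_le hR]
    refine setIntegral_congr_fun measurableSet_Ioc fun ρ hρ => ?_
    exact Real.norm_of_nonneg (mul_nonneg hρ.1.le (sq_nonneg _))

/-- A majorant for the squared sizes of the angular modes of a function with bounded `∂̄`. -/
def modeWeight (n : ℤ) : ℝ := (if n = 1 then 1 else 0) + 1 / ((n - 1 : ℤ) : ℝ) ^ 2

lemma summable_modeWeight : Summable modeWeight := by
  refine Summable.add ?_ ?_
  · exact summable_of_ne_finset_zero (s := {1}) fun n hn => by
      simp at hn; simp [hn]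
  · exact (Real.summable_one_div_int_pow.2 one_lt_two).comp_injective
      (sub_left_injective (b := (1 : ℤ)))

section Disc

variable {f F G : ℂ → ℂ} {K M : ℝ}

lemma hasDerivAt_radius
    (hf : ∀ z, HasFDerivAt f (F z • (1 : ℂ →L[ℝ] ℂ) + G z • (conjCLE : ℂ →L[ℝ] ℂ)) z)
    (c : ℂ) (ρ θ : ℝ) :
    HasDerivAt (fun s : ℝ => f (c + s * exp (θ * I)))
      (F (c + ρ * exp (θ * I)) * exp (θ * I) + G (c + ρ * exp (θ * I)) * exp (-(θ * I))) ρ := by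
  have h1 : HasDerivAt (fun s : ℝ => c + s * exp (θ * I)) (1 * exp (θ * I)) ρ :=
    (((hasDerivAt_id ρ).ofReal_comp).mul_const _).const_add c
  refine ((hf _).comp_hasDerivAt ρ h1).congr_deriv ?_
  simp [← exp_conj]

lemma hasDerivAt_angle
    (hf : ∀ z, HasFDerivAt f (F z • (1 : ℂ →L[ℝ] ℂ) + G z • (conjCLE : ℂ →L[ℝ] ℂ)) z)
    (c : ℂ) (ρ θ : ℝ) :
    HasDerivAt (fun θ : ℝ => f (c + ρ * exp (θ * I)))
      ((ρ * I) * (F (c + ρ * exp (θ * I)) * exp (θ * I)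
        + (-1) * (G (c + ρ * exp (θ * I)) * exp (-(θ * I))))) θ := by
  have h0 : HasDerivAt (fun θ : ℝ => (θ : ℂ) * I) (1 * I) θ :=
    ((hasDerivAt_id θ).ofReal_comp).mul_const _
  have h1 : HasDerivAt (fun θ : ℝ => c + ρ * exp (θ * I)) (ρ * (exp (θ * I) * (1 * I))) θ :=
    (h0.cexp.const_mul _).const_add c
  refine ((hf _).comp_hasDerivAt θ h1).congr_deriv ?_
  simp [← exp_conj]
  ring

/-- The mean oscillation over discs of `∂f` is controlled by the supremum of `∂̄f`. -/
lemma exists_integral_polar_le (hFc : Continuous F) (hGc : Continuous G)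
    (hf : ∀ z, HasFDerivAt f (F z • (1 : ℂ →L[ℝ] ℂ) + G z • (conjCLE : ℂ →L[ℝ] ℂ)) z)
    (hM : ∀ z, ‖f z‖ ≤ M) (hK : ∀ z, ‖G z‖ ≤ K) (c : ℂ) {R : ℝ} (hR : 0 < R) :
    ∃ b : ℂ, ∫ ρ in 0..R, ρ * ((2 * Real.pi)⁻¹ *
      ∫ θ in (-Real.pi)..Real.pi, ‖F (c + ρ * exp (θ * I)) - b‖ ^ 2)
      ≤ (132 + 128 * ∑' n, modeWeight n) * (K * R) ^ 2 := by
  have hfc : Continuous f := continuous_iff_continuousAt.2 fun z => (hf z).continuousAt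
  have hK0 : 0 ≤ K := (norm_nonneg _).trans (hK 0)
  set a : ℤ → ℝ → ℂ := fun n ρ => circleCoeff (fun θ => f (c + ρ * exp (θ * I))) n with ha_def
  set Fc : ℤ → ℝ → ℂ := fun n ρ =>
    circleCoeff (fun θ => F (c + ρ * exp (θ * I)) * exp (θ * I)) n with hFc_def
  set g : ℤ → ℝ → ℂ := fun n ρ =>
    circleCoeff (fun θ => G (c + ρ * exp (θ * I)) * exp (-(θ * I))) n with hg_def
  have hFcont : ∀ n, Continuous (Fc n) := fun n =>
    continuous_circleCoeff (φ := fun (ρ θ : ℝ) => F (c + ρ * exp (θ * I)) * exp (θ * I))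
      (by simp only [Function.uncurry_def]; fun_prop) n
  have hgcont : ∀ n, Continuous (g n) := fun n =>
    continuous_circleCoeff (φ := fun (ρ θ : ℝ) => G (c + ρ * exp (θ * I)) * exp (-(θ * I)))
      (by simp only [Function.uncurry_def]; fun_prop) n
  have ha : ∀ n ρ, HasDerivAt (a n) ((Fc n ρ - g n ρ) + 2 * g n ρ) ρ := by
    intro n ρ
    have h := hasDerivAt_circleCoeff (hasDerivAt_radius hf c)
      (by simp only [Function.uncurry_def]; fun_prop)
      (by simp only [Function.uncurry_def]; fun_prop) n ρ
    refine h.congr_deriv ?_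
    rw [circleCoeff_add (by fun_prop) (by fun_prop)]
    simp only [hFc_def, hg_def]
    ring
  have had : ∀ (n : ℤ) (ρ : ℝ), (n : ℂ) * a n ρ = ρ * (Fc n ρ - g n ρ) := by
    intro n ρ
    have h := circleCoeff_deriv (hasDerivAt_angle hf c ρ) (by fun_prop) (by
      have : exp ((Real.pi : ℝ) * I) = exp ((-Real.pi : ℝ) * I) := by
        rw [exp_eq_exp_iff_exists_int]
        exact ⟨1, by push_cast; ring⟩
      simp only [this]) n
    rw [circleCoeff_const_mul, circleCoeff_add (by fun_prop) (by fun_prop),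
      circleCoeff_const_mul] at h
    have h2 : I * ((n : ℂ) * a n ρ) = I * (ρ * (Fc n ρ - g n ρ)) := by
      simp only [ha_def, hFc_def, hg_def]
      linear_combination -h
    exact mul_left_cancel₀ I_ne_zero h2
  have hgK : ∀ n ρ, ‖g n ρ‖ ≤ K := fun n ρ => norm_circleCoeff_le (fun θ => by
    rw [norm_mul, show -((θ : ℂ) * I) = ((-θ : ℝ) : ℂ) * I by push_cast; ring,
      norm_exp_ofReal_mul_I, mul_one]
    exact hK _) n
  have haM : ∀ n ρ, ‖a n ρ‖ ≤ M := fun n ρ => norm_circleCoeff_le (fun θ => hM _) n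
  set b : ℂ := Fc 1 (2 * R) - g 1 (2 * R) with hb
  set b' : ℤ → ℂ := fun n => if n = 1 then b else 0 with hb'
  have hmode : ∀ n, ∫ ρ in 0..R, ρ * ‖Fc n ρ - g n ρ - b' n‖ ^ 2
      ≤ 32 * (∫ ρ in 0..2 * R, ρ * ‖g n ρ‖ ^ 2) + 4 * (16 * (K * R) ^ 2 * modeWeight n) := by
    intro n
    have hgint : 0 ≤ ∫ ρ in 0..2 * R, ρ * ‖g n ρ‖ ^ 2 :=
      intervalIntegral.integral_nonneg (by positivity) fun ρ hρ => mul_nonneg hρ.1 (sq_nonneg _)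
    have hFn := hFcont n
    have hgn := hgcont n
    rcases lt_trichotomy n 0 with hn | hn | hn
    · have hn1 : n ≠ 1 := by omega
      have h := integral_sq_le_of_radial_ode_half (A := 0) hR (m := (n : ℝ))
        (by exact_mod_cast hn.ne) (d := fun ρ => Fc n ρ - g n ρ) (by fun_prop) hgn (ha n)
        (fun ρ => by exact_mod_cast had n ρ) (Or.inl (by exact_mod_cast hn))
      have hw : 0 ≤ modeWeight n := by
        rw [modeWeight, if_neg hn1]; positivity
      simp only [hb', if_neg hn1, sub_zero]
      have : 0 ≤ 4 * (16 * (K * R) ^ 2 * modeWeight n) := by positivity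
      linarith
    · have hn1 : n ≠ 1 := by omega
      have hw : 0 ≤ modeWeight n := by
        rw [modeWeight, if_neg hn1]; positivity
      have : ∫ ρ in 0..R, ρ * ‖Fc n ρ - g n ρ - b' n‖ ^ 2 = 0 := by
        have e : ∀ ρ : ℝ, ρ * ‖Fc n ρ - g n ρ - b' n‖ ^ 2 = 0 := by
          intro ρ
          have h := had n ρ
          rw [hn] at h
          simp only [hb', if_neg hn1, sub_zero]
          rw [hn]
          simp only [Int.cast_zero, zero_mul, zero_eq_mul, ofReal_eq_zero] at h
          rcases h with h | h <;> simp [h]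
        simp [e]
      rw [this]
      positivity
    · obtain ⟨k, rfl⟩ : ∃ k : ℕ, n = k + 1 := ⟨(n - 1).toNat, by omega⟩
      rcases k with _ | k
      · norm_num at *
        have hA : ∀ ρ ∈ Icc 0 (2 * R), ‖a 1 ρ - ρ * b‖ ≤ 4 * (K * R) := by
          intro ρ hρ
          have := norm_sub_le_of_radial_ode_one (d := fun ρ => Fc 1 ρ - g 1 ρ) (ha 1)
            (fun ρ => by simpa using had 1 ρ) (hgK 1) hρ
          linarith
        have h := integral_sq_le_of_radial_ode_half (A := 4 * (K * R)) hR (m := (1 : ℝ))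
          one_ne_zero (a := fun ρ => a 1 ρ - ρ * b) (d := fun ρ => Fc 1 ρ - g 1 ρ - b)
          (by fun_prop) hgn (fun ρ => by
            refine ((ha 1 ρ).sub (((hasDerivAt_id ρ).ofReal_comp).mul_const b)).congr_deriv ?_
            simp only [ofReal_one]
            ring) (fun ρ => by
            have := had 1 ρ
            simp only [Int.cast_one, one_mul] at this
            simp only [ofReal_one, one_mul, this]; ring) (Or.inr hA)
        simp only [hb', modeWeight, if_true]
        refine h.trans (le_of_eq ?_)
        norm_num
        ring
      · have hk : ((k + 1 : ℕ) + 1 : ℤ) = ((k + 2 : ℕ) : ℤ) := by push_cast; ring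
        rw [hk] at hgint hFn hgn ⊢
        have hn1 : ((k + 2 : ℕ) : ℤ) ≠ 1 := by omega
        have had' : ∀ ρ : ℝ, ((k + 2 : ℕ) : ℂ) * a (k + 2 : ℕ) ρ
            = ρ * (Fc (k + 2 : ℕ) ρ - g (k + 2 : ℕ) ρ) := fun ρ => by
          have := had (k + 2 : ℕ) ρ
          rwa [Int.cast_natCast] at this
        have hA : ∀ ρ ∈ Icc 0 (2 * R), ‖a (k + 2 : ℕ) ρ‖ ≤ 4 * (K * R) / (k + 1) := by
          intro ρ hρ
          rcases hρ.1.eq_or_lt with h0 | h0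
          · have h := had' 0
            rw [ofReal_zero, zero_mul, mul_eq_zero] at h
            rcases h with h | h
            · exact absurd h (by exact_mod_cast (by omega : k + 2 ≠ 0))
            · rw [← h0, h, norm_zero]; positivity
          · refine (norm_le_of_radial_ode_two_le (ha (k + 2 : ℕ)) had' (hgK _) (haM _) h0).trans ?_
            refine div_le_div_of_nonneg_right ?_ (by positivity)
            nlinarith [mul_le_mul_of_nonneg_left hρ.2 hK0]
        have h := integral_sq_le_of_radial_ode_half hR (m := ((k + 2 : ℕ) : ℝ))
          (by positivity) (d := fun ρ => Fc (k + 2 : ℕ) ρ - g (k + 2 : ℕ) ρ) (by fun_prop) hgn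
          (ha (k + 2 : ℕ)) (fun ρ => by rw [ofReal_natCast]; exact had' ρ) (Or.inr hA)
        simp only [hb', if_neg hn1, sub_zero, modeWeight]
        have e : ((((k + 2 : ℕ) : ℤ) - 1 : ℤ) : ℝ) = k + 1 := by push_cast; ring
        refine h.trans (le_of_eq ?_)
        rw [e, div_pow]
        ring
  refine ⟨b, ?_⟩
  have hE : ∀ n (ρ : ℝ), circleCoeff (fun θ => (F (c + ρ * exp (θ * I)) - b) * exp (θ * I)) n
      = Fc n ρ - b' n := by
    intro n ρ
    have e : (fun θ : ℝ => (F (c + ρ * exp (θ * I)) - b) * exp (θ * I))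
        = fun θ : ℝ => F (c + ρ * exp (θ * I)) * exp (θ * I) + (-b) * exp (θ * I) := by
      funext θ; ring
    rw [e, circleCoeff_add (by fun_prop) (by fun_prop), circleCoeff_const_mul,
      circleCoeff_exp_mul_I]
    simp only [hFc_def, hb']
    split_ifs <;> ring
  have hsumF := hasSum_integral_sq_circleCoeff
    (Φ := fun (ρ θ : ℝ) => (F (c + ρ * exp (θ * I)) - b) * exp (θ * I))
    (by simp only [Function.uncurry_def]; fun_prop) hR.le
  have hsumG := hasSum_integral_sq_circleCoeff
    (Φ := fun (ρ θ : ℝ) => G (c + ρ * exp (θ * I)) * exp (-(θ * I)))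
    (by simp only [Function.uncurry_def]; fun_prop) (by positivity : 0 ≤ 2 * R)
  simp only [hE, norm_mul, norm_exp_ofReal_mul_I, mul_one] at hsumF
  have hterm : ∀ n, ∫ ρ in 0..R, ρ * ‖Fc n ρ - b' n‖ ^ 2
      ≤ 66 * (∫ ρ in 0..2 * R, ρ * ‖g n ρ‖ ^ 2) + 128 * (K * R) ^ 2 * modeWeight n := by
    intro n
    have hFn := hFcont n
    have hgn := hgcont n
    have h1 : ∫ ρ in 0..R, ρ * ‖Fc n ρ - b' n‖ ^ 2
        ≤ ∫ ρ in 0..R, (2 * (ρ * ‖Fc n ρ - g n ρ - b' n‖ ^ 2) + 2 * (ρ * ‖g n ρ‖ ^ 2)) := by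
      refine intervalIntegral.integral_mono_on hR.le
        (Continuous.intervalIntegrable (by fun_prop) _ _)
        (Continuous.intervalIntegrable (by fun_prop) _ _) fun ρ hρ => ?_
      have h3 : ‖Fc n ρ - b' n‖ ≤ ‖Fc n ρ - g n ρ - b' n‖ + ‖g n ρ‖ := by
        refine le_trans (le_of_eq ?_) (norm_add_le _ _)
        congr 1; ring
      have h4 : ‖Fc n ρ - b' n‖ ^ 2 ≤ 2 * ‖Fc n ρ - g n ρ - b' n‖ ^ 2 + 2 * ‖g n ρ‖ ^ 2 := by
        nlinarith [norm_nonneg (Fc n ρ - b' n),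
          sq_nonneg (‖Fc n ρ - g n ρ - b' n‖ - ‖g n ρ‖)]
      nlinarith [mul_le_mul_of_nonneg_left h4 hρ.1]
    have h2 : ∫ ρ in 0..R, ρ * ‖g n ρ‖ ^ 2 ≤ ∫ ρ in 0..2 * R, ρ * ‖g n ρ‖ ^ 2 := by
      refine intervalIntegral.integral_mono_interval le_rfl hR.le (by linarith) ?_
        (Continuous.intervalIntegrable (by fun_prop) _ _)
      refine (ae_restrict_iff' measurableSet_Ioc).2 (Filter.Eventually.of_forall fun ρ hρ => ?_)
      exact mul_nonneg hρ.1.le (sq_nonneg _)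
    rw [intervalIntegral.integral_add (Continuous.intervalIntegrable (by fun_prop) _ _)
      (Continuous.intervalIntegrable (by fun_prop) _ _), intervalIntegral.integral_const_mul,
      intervalIntegral.integral_const_mul] at h1
    linarith [hmode n]
  have htot := hasSum_le hterm hsumF
    ((hsumG.mul_left 66).add (summable_modeWeight.hasSum.mul_left (128 * (K * R) ^ 2)))
  have hG : ∫ ρ in 0..2 * R, ρ * ((2 * Real.pi)⁻¹ * ∫ θ in (-Real.pi)..Real.pi,
      ‖G (c + ρ * exp (θ * I)) * exp (-(θ * I))‖ ^ 2) ≤ ∫ ρ in 0..2 * R, ρ * K ^ 2 := by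
    have hcont : Continuous fun ρ : ℝ => ∫ θ in (-Real.pi)..Real.pi,
        ‖G (c + ρ * exp (θ * I)) * exp (-(θ * I))‖ ^ 2 := by
      refine intervalIntegral.continuous_parametric_intervalIntegral_of_continuous' ?_ _ _
      simp only [Function.uncurry_def]
      fun_prop
    refine intervalIntegral.integral_mono_on (by positivity)
      (Continuous.intervalIntegrable (by fun_prop) _ _)
      (Continuous.intervalIntegrable (by fun_prop) _ _) fun ρ hρ => ?_
    refine mul_le_mul_of_nonneg_left ?_ hρ.1
    rw [inv_mul_le_iff₀ Real.two_pi_pos]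
    have h5 : ∫ θ in (-Real.pi)..Real.pi, ‖G (c + ρ * exp (θ * I)) * exp (-(θ * I))‖ ^ 2
        ≤ ∫ _θ in (-Real.pi)..Real.pi, K ^ 2 := by
      refine intervalIntegral.integral_mono_on (by linarith [Real.pi_pos])
        (Continuous.intervalIntegrable (by fun_prop) _ _)
        (Continuous.intervalIntegrable (by fun_prop) _ _) fun θ _ => ?_
      rw [norm_mul, show -((θ : ℂ) * I) = ((-θ : ℝ) : ℂ) * I by push_cast; ring,
        norm_exp_ofReal_mul_I, mul_one]
      gcongr
      exact hK _
    rw [intervalIntegral.integral_const, smul_eq_mul] at h5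
    linarith
  rw [intervalIntegral.integral_mul_const, integral_id] at hG
  nlinarith

end Disc

/-- The closed unit square in the complex plane. -/
def unitSquare : Set ℂ := Icc 0 1 ×ℂ Icc 0 1

lemma isCompact_unitSquare : IsCompact unitSquare := isCompact_Icc.reProdIm isCompact_Icc

lemma integrableOn_unitSquare {φ : ℂ → ℝ} (hφ : Continuous φ) : IntegrableOn φ unitSquare :=
  hφ.continuousOn.integrableOn_compact isCompact_unitSquare

lemma norm_le_two_of_mem_unitSquare {z : ℂ} (hz : z ∈ unitSquare) : ‖z‖ ≤ 2 := by
  obtain ⟨⟨h1, h2⟩, h3, h4⟩ := mem_reProdIm.1 hz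
  have h := norm_le_abs_re_add_abs_im z
  rw [abs_of_nonneg h1, abs_of_nonneg h3] at h
  linarith

lemma integral_unitSquare_eq {φ : ℂ → ℝ} (hφ : Continuous φ) :
    ∫ z in unitSquare, φ z = ∫ s in (0 : ℝ)..1, ∫ t in (0 : ℝ)..1, φ (s + t * I) := by
  have e : unitSquare = measurableEquivRealProd ⁻¹' (Icc (0 : ℝ) 1 ×ˢ Icc (0 : ℝ) 1) := rfl
  have h := volume_preserving_equiv_real_prod.setIntegral_preimage_emb
    measurableEquivRealProd.measurableEmbedding (fun p : ℝ × ℝ => φ (p.1 + p.2 * I))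
    (Icc (0 : ℝ) 1 ×ˢ Icc (0 : ℝ) 1)
  simp only [measurableEquivRealProd_apply, re_add_im] at h
  rw [e, h, Measure.volume_eq_prod, setIntegral_prod, intervalIntegral.integral_of_le zero_le_one,
    integral_Icc_eq_integral_Ioc]
  · refine setIntegral_congr_fun measurableSet_Ioc fun s _ => ?_
    rw [intervalIntegral.integral_of_le zero_le_one, integral_Icc_eq_integral_Ioc]
  · exact Continuous.continuousOn (by fun_prop) |>.integrableOn_compact
      (isCompact_Icc.prod isCompact_Icc)

lemma volume_unitSquare : volume unitSquare = 1 := by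
  have e : unitSquare = measurableEquivRealProd ⁻¹' (Icc (0 : ℝ) 1 ×ˢ Icc (0 : ℝ) 1) := rfl
  rw [e, volume_preserving_equiv_real_prod.measure_preimage
    (measurableSet_Icc.prod measurableSet_Icc).nullMeasurableSet, Measure.volume_eq_prod,
    Measure.prod_prod]
  simp

instance : IsProbabilityMeasure (volume.restrict unitSquare) :=
  ⟨by rw [Measure.restrict_apply_univ, volume_unitSquare]⟩

lemma integral_unitSquare_le_polar {ψ : ℂ → ℝ} (hψ : Continuous ψ) (h0 : ∀ z, 0 ≤ ψ z) :
    ∫ z in unitSquare, ψ z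
      ≤ ∫ ρ in (0 : ℝ)..2, ρ * ∫ θ in (-Real.pi)..Real.pi, ψ (ρ * exp (θ * I)) := by
  have hπ : -Real.pi ≤ Real.pi := by linarith [Real.pi_pos]
  have hint : IntegrableOn ψ (Metric.closedBall 0 2) :=
    hψ.continuousOn.integrableOn_compact (isCompact_closedBall _ _)
  have hsub : unitSquare ⊆ Metric.closedBall 0 2 := fun z hz => by
    simpa using norm_le_two_of_mem_unitSquare hz
  refine (setIntegral_mono_set hint (ae_of_all _ h0) hsub.eventuallyLE).trans (le_of_eq ?_)
  rw [← integral_indicator Metric.isClosed_closedBall.measurableSet,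
    ← Complex.integral_comp_polarCoord_symm]
  have e1 : ∫ p in polarCoord.target, p.1 •
        (Metric.closedBall (0 : ℂ) 2).indicator ψ (Complex.polarCoord.symm p)
      = ∫ p in polarCoord.target, (Iic (2 : ℝ) ×ˢ (univ : Set ℝ)).indicator
          (fun p : ℝ × ℝ => p.1 * ψ (p.1 * exp (p.2 * I))) p := by
    refine setIntegral_congr_fun polarCoord.open_target.measurableSet fun p hp => ?_
    have hp1 : 0 < p.1 := hp.1
    have hn := Complex.norm_polarCoord_symm p
    rw [abs_of_pos hp1] at hn
    by_cases hp2 : p.1 ≤ 2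
    · rw [indicator_of_mem (by rwa [mem_closedBall_zero_iff, hn]),
        indicator_of_mem (by simpa using hp2),
        Complex.polarCoord_symm_apply, exp_mul_I, smul_eq_mul, ofReal_cos, ofReal_sin]
    · rw [indicator_of_notMem (by rwa [mem_closedBall_zero_iff, hn]),
        indicator_of_notMem (by simpa using hp2), smul_zero]
  have e2 : polarCoord.target ∩ (Iic (2 : ℝ) ×ˢ (univ : Set ℝ))
      = Ioc (0 : ℝ) 2 ×ˢ Ioo (-Real.pi) Real.pi := by
    rw [polarCoord_target, prod_inter_prod, inter_univ, Ioi_inter_Iic]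
  rw [e1, setIntegral_indicator (measurableSet_Iic.prod MeasurableSet.univ), e2,
    Measure.volume_eq_prod, setIntegral_prod, intervalIntegral.integral_of_le zero_le_two]
  · refine setIntegral_congr_fun measurableSet_Ioc fun ρ _ => ?_
    simp only
    rw [integral_const_mul, intervalIntegral.integral_of_le hπ, integral_Ioc_eq_integral_Ioo]
  · refine IntegrableOn.mono_set (t := Icc (0 : ℝ) 2 ×ˢ Icc (-Real.pi) Real.pi) ?_
      (prod_mono Ioc_subset_Icc_self Ioo_subset_Icc_self)
    exact Continuous.continuousOn (by fun_prop) |>.integrableOn_compact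
      (isCompact_Icc.prod isCompact_Icc)

/-- The mean square oscillation constant of `∂f` over squares, for bounded `∂̄f`. -/
def oscConst : ℝ := 8 * Real.pi * (132 + 128 * ∑' n, modeWeight n)

lemma oscConst_pos : 0 < oscConst := by
  have : 0 ≤ ∑' n, modeWeight n := tsum_nonneg fun n => by
    unfold modeWeight; split_ifs <;> positivity
  unfold oscConst
  positivity

lemma exists_integral_unitSquare_sq_le {f F G : ℂ → ℂ} {K M : ℝ}
    (hFc : Continuous F) (hGc : Continuous G)
    (hf : ∀ z, HasFDerivAt f (F z • (1 : ℂ →L[ℝ] ℂ) + G z • (conjCLE : ℂ →L[ℝ] ℂ)) z)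
    (hM : ∀ z, ‖f z‖ ≤ M) (hK : ∀ z, ‖G z‖ ≤ K) (c : ℂ) {r : ℝ} (hr : 0 < r) :
    ∃ b : ℂ, ∫ z in unitSquare, ‖F (c + r * z) - b‖ ^ 2 ≤ oscConst * K ^ 2 := by
  obtain ⟨b, hb⟩ := exists_integral_polar_le hFc hGc hf hM hK c (R := 2 * r) (by positivity)
  refine ⟨b, ?_⟩
  refine (integral_unitSquare_le_polar (ψ := fun z => ‖F (c + r * z) - b‖ ^ 2) (by fun_prop)
    fun z => by positivity).trans ?_
  have h := intervalIntegral.smul_integral_comp_mul_left (a := 0) (b := 2)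
    (fun ρ : ℝ => ρ * ((2 * Real.pi)⁻¹ * ∫ θ in (-Real.pi)..Real.pi,
      ‖F (c + ρ * exp (θ * I)) - b‖ ^ 2)) r
  rw [mul_zero, mul_comm r 2] at h
  rw [← h, smul_eq_mul] at hb
  have e : ∫ ρ in (0 : ℝ)..2, (r * ρ) * ((2 * Real.pi)⁻¹ * ∫ θ in (-Real.pi)..Real.pi,
        ‖F (c + (r * ρ : ℝ) * exp (θ * I)) - b‖ ^ 2)
      = (r * (2 * Real.pi)⁻¹) * ∫ ρ in (0 : ℝ)..2, ρ * ∫ θ in (-Real.pi)..Real.pi,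
        ‖F (c + r * (ρ * exp (θ * I))) - b‖ ^ 2 := by
    rw [← intervalIntegral.integral_const_mul]
    refine intervalIntegral.integral_congr fun ρ _ => ?_
    simp only [ofReal_mul, mul_assoc]
    ring
  rw [e] at hb
  set J := ∫ ρ in (0 : ℝ)..2, ρ * ∫ θ in (-Real.pi)..Real.pi,
        ‖F (c + r * (ρ * exp (θ * I))) - b‖ ^ 2
  have hπ := Real.pi_pos
  have e3 : J = 2 * Real.pi / r ^ 2 * (r * (r * (2 * Real.pi)⁻¹ * J)) := by
    field_simp
  rw [e3]
  refine (mul_le_mul_of_nonneg_left hb (by positivity)).trans (le_of_eq ?_)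
  unfold oscConst
  field_simp
  ring

lemma integral_unit_interval_split {φ : ℝ → ℝ} (hφ : Continuous φ) :
    ∫ s in (0 : ℝ)..1, φ s
      = ((∫ s in (0 : ℝ)..1, φ (s / 2)) + ∫ s in (0 : ℝ)..1, φ (1 / 2 + s / 2)) / 2 := by
  rw [intervalIntegral.integral_comp_div φ two_ne_zero,
    intervalIntegral.integral_comp_add_div φ two_ne_zero,
    ← intervalIntegral.integral_add_adjacent_intervals (b := 1 / 2)
      (hφ.intervalIntegrable _ _) (hφ.intervalIntegrable _ _)]
  norm_num
  ring

lemma integral_unit_interval_prod_split {Φ : ℝ → ℝ → ℝ} (hΦ : Continuous (Function.uncurry Φ)) :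
    ∫ s in (0 : ℝ)..1, ∫ t in (0 : ℝ)..1, Φ s t
      = ((∫ s in (0 : ℝ)..1, ∫ t in (0 : ℝ)..1, Φ (s / 2) (t / 2))
        + (∫ s in (0 : ℝ)..1, ∫ t in (0 : ℝ)..1, Φ (1 / 2 + s / 2) (t / 2))
        + (∫ s in (0 : ℝ)..1, ∫ t in (0 : ℝ)..1, Φ (s / 2) (1 / 2 + t / 2))
        + ∫ s in (0 : ℝ)..1, ∫ t in (0 : ℝ)..1, Φ (1 / 2 + s / 2) (1 / 2 + t / 2)) / 4 := by
  have hcomp : ∀ {α β : ℝ × ℝ → ℝ}, Continuous α → Continuous β →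
      Continuous fun p => Φ (α p) (β p) := fun hα hβ => hΦ.comp (hα.prodMk hβ)
  have hin : ∀ {α β : ℝ → ℝ}, Continuous α → Continuous β →
      Continuous fun s : ℝ => ∫ t in (0 : ℝ)..1, Φ (α s) (β t) := fun {α β} hα hβ =>
    intervalIntegral.continuous_parametric_intervalIntegral_of_continuous'
      (f := fun s t => Φ (α s) (β t)) (hcomp (hα.comp continuous_fst) (hβ.comp continuous_snd)) _ _
  have key : ∀ {α : ℝ → ℝ}, Continuous α → ∫ s in (0 : ℝ)..1, ∫ t in (0 : ℝ)..1, Φ (α s) t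
      = ((∫ s in (0 : ℝ)..1, ∫ t in (0 : ℝ)..1, Φ (α s) (t / 2))
        + ∫ s in (0 : ℝ)..1, ∫ t in (0 : ℝ)..1, Φ (α s) (1 / 2 + t / 2)) / 2 := by
    intro α hα
    rw [← intervalIntegral.integral_add
      ((hin hα (β := fun t => t / 2) (by fun_prop)).intervalIntegrable _ _)
      ((hin hα (β := fun t => 1 / 2 + t / 2) (by fun_prop)).intervalIntegrable _ _),
      ← intervalIntegral.integral_div]
    refine intervalIntegral.integral_congr fun s _ => ?_
    exact integral_unit_interval_split (hΦ.comp (continuous_const.prodMk continuous_id))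
  rw [integral_unit_interval_split (hin (α := fun s => s) (β := fun t => t) (by fun_prop)
      (by fun_prop)),
    key (α := fun s => s / 2) (by fun_prop), key (α := fun s => 1 / 2 + s / 2) (by fun_prop)]
  ring

lemma integral_unitSquare_split {φ : ℂ → ℝ} (hφ : Continuous φ) (c : ℂ) (r : ℝ) :
    ∫ z in unitSquare, φ (c + r * z)
      = (∑ i : Fin 4, ∫ z in unitSquare,
          φ (c + (r / 2 : ℝ) * (![0, 1, I, 1 + I] : Fin 4 → ℂ) i + (r / 2 : ℝ) * z)) / 4 := by
  have h : ∀ e : ℂ, ∫ z in unitSquare, φ (c + (r / 2 : ℝ) * e + (r / 2 : ℝ) * z)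
      = ∫ s in (0 : ℝ)..1, ∫ t in (0 : ℝ)..1,
          φ (c + (r / 2 : ℝ) * e + (r / 2 : ℝ) * (s + t * I)) :=
    fun e => integral_unitSquare_eq (by fun_prop)
  rw [integral_unitSquare_eq (by fun_prop), integral_unit_interval_prod_split
    (Φ := fun s t : ℝ => φ (c + r * (s + t * I))) (by simp only [Function.uncurry_def]; fun_prop),
    Fin.sum_univ_four, h, h, h, h]
  congr 1
  congr 1
  · congr 1
    · congr 1 <;> refine intervalIntegral.integral_congr fun s _ =>
        intervalIntegral.integral_congr fun t _ => congrArg φ ?_ <;> simp <;> ring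
    · refine intervalIntegral.integral_congr fun s _ =>
        intervalIntegral.integral_congr fun t _ => congrArg φ ?_
      simp
      ring
  · refine intervalIntegral.integral_congr fun s _ =>
      intervalIntegral.integral_congr fun t _ => congrArg φ ?_
    simp
    ring

lemma exp_mul_bellman_le {d w v : ℝ} (hd : |d| ≤ 2) (hw : w ∈ Icc (0 : ℝ) 1)
    (hv : v ∈ Icc (0 : ℝ) 1) :
    Real.exp (d / 3) * (1 + v - v ^ 2 / 4)
      ≤ (1 + w - w ^ 2 / 4) + (1 - w / 2) * (v - w) + d / 3 * (1 + w - w ^ 2 / 4) + d ^ 2 / 2 := by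
  obtain ⟨h1, h2⟩ := abs_le.1 hd
  obtain ⟨hw0, hw1⟩ := hw
  obtain ⟨hv0, hv1⟩ := hv
  have hx : |d / 3| ≤ 1 := by rw [abs_le]; constructor <;> linarith
  have he : Real.exp (d / 3) ≤ 1 + d / 3 + (d / 3) ^ 2 := by
    have := (abs_le.1 (Real.abs_exp_sub_one_sub_id_le hx)).2
    linarith
  have hg : 0 ≤ 1 + v - v ^ 2 / 4 := by nlinarith
  have hg' : 1 + v - v ^ 2 / 4 ≤ 7 / 4 := by nlinarith
  refine (mul_le_mul_of_nonneg_right he hg).trans ?_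
  set x := d / 3 with hxd
  have hd' : d = 3 * x := by rw [hxd]; ring
  rw [hd']
  have hs : x * (v - w) * (1 - (w + v) / 4) ≤ (v - w) ^ 2 / 4 + x ^ 2 := by
    nlinarith [sq_nonneg ((v - w) / 2 - x * (1 - (w + v) / 4)), sq_nonneg x,
      mul_nonneg (sq_nonneg x) (by nlinarith : 0 ≤ 1 - (1 - (w + v) / 4) ^ 2)]
  have hq : x ^ 2 * (1 + v - v ^ 2 / 4) ≤ x ^ 2 * (7 / 4) :=
    mul_le_mul_of_nonneg_left hg' (sq_nonneg x)
  nlinarith [sq_nonneg x]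

/-- The concavity-type inequality driving the dyadic induction: here `m i`, `q i` are the first and
second moments on the four children of a square. -/
lemma bellman_four {m q : Fin 4 → ℝ} (hv : ∀ i, q i - m i ^ 2 ∈ Icc (0 : ℝ) 1) {M Q : ℝ}
    (hM : M = (∑ i, m i) / 4) (hQ : Q = (∑ i, q i) / 4) (hw : Q - M ^ 2 ∈ Icc (0 : ℝ) 1) :
    (∑ i, Real.exp (m i / 3) * (1 + (q i - m i ^ 2) - (q i - m i ^ 2) ^ 2 / 4)) / 4
      ≤ Real.exp (M / 3) * (1 + (Q - M ^ 2) - (Q - M ^ 2) ^ 2 / 4) := by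
  set w := Q - M ^ 2 with hwdef
  have hsum : ∑ i, (q i - m i ^ 2) + ∑ i, (m i - M) ^ 2 = 4 * w := by
    simp only [Fin.sum_univ_four] at *
    rw [hwdef, hQ, hM]
    ring
  have hsd : ∑ i, (m i - M) = 0 := by
    rw [Finset.sum_sub_distrib, hM]; simp; ring
  have hd : ∀ i, |m i - M| ≤ 2 := by
    intro i
    have h1 : (m i - M) ^ 2 ≤ ∑ i, (m i - M) ^ 2 :=
      Finset.single_le_sum (f := fun i => (m i - M) ^ 2) (fun j _ => sq_nonneg _)
        (Finset.mem_univ i)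
    have h2 : 0 ≤ ∑ i, (q i - m i ^ 2) := Finset.sum_nonneg fun j _ => (hv j).1
    exact abs_le.2 (abs_le_of_sq_le_sq' (by linarith [hw.2]) zero_le_two)
  have hS : 0 ≤ ∑ i, (m i - M) ^ 2 := Finset.sum_nonneg fun j _ => sq_nonneg _
  have hp := Finset.sum_le_sum fun i (_ : i ∈ Finset.univ) => exp_mul_bellman_le (hd i) hw (hv i)
  have e : ∀ i, Real.exp (m i / 3) = Real.exp (M / 3) * Real.exp ((m i - M) / 3) := fun i => by
    rw [← Real.exp_add]; congr 1; ring
  simp only [e, mul_assoc]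
  rw [← Finset.mul_sum, mul_div_assoc]
  refine mul_le_mul_of_nonneg_left ?_ (Real.exp_pos _).le
  have e2 : ∑ i, ((1 + w - w ^ 2 / 4) + (1 - w / 2) * ((q i - m i ^ 2) - w)
      + (m i - M) / 3 * (1 + w - w ^ 2 / 4) + (m i - M) ^ 2 / 2)
      = 4 * (1 + w - w ^ 2 / 4) + (1 - w / 2) * (∑ i, (q i - m i ^ 2) - 4 * w)
        + (∑ i, (m i - M)) / 3 * (1 + w - w ^ 2 / 4) + (∑ i, (m i - M) ^ 2) / 2 := by
    simp only [Fin.sum_univ_four]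
    ring
  rw [e2, hsd] at hp
  nlinarith [hw.1, hw.2]

lemma integral_unitSquare_sub_sq {h : ℂ → ℝ} (hc : Continuous h) (b : ℝ) :
    ∫ z in unitSquare, (h z - b) ^ 2
      = (∫ z in unitSquare, h z ^ 2) - 2 * b * (∫ z in unitSquare, h z) + b ^ 2 := by
  have h1 : IntegrableOn (fun z => 2 * b * h z) unitSquare := integrableOn_unitSquare (by fun_prop)
  have h2 : IntegrableOn (fun z => h z ^ 2) unitSquare := integrableOn_unitSquare (by fun_prop)
  have h3 : IntegrableOn (fun z => h z ^ 2 - 2 * b * h z) unitSquare :=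
    integrableOn_unitSquare (by fun_prop)
  have e : (fun z => (h z - b) ^ 2) = fun z => (h z ^ 2 - 2 * b * h z) + b ^ 2 := by
    funext z; ring
  rw [e, integral_add h3 (integrable_const _), integral_sub h2 h1, integral_const_mul,
    integral_const]
  simp

lemma sq_integral_unitSquare_le {h : ℂ → ℝ} (hc : Continuous h) :
    (∫ z in unitSquare, h z) ^ 2 ≤ ∫ z in unitSquare, h z ^ 2 := by
  have h1 := integral_unitSquare_sub_sq hc (∫ z in unitSquare, h z)
  have h2 : 0 ≤ ∫ z in unitSquare, (h z - ∫ z in unitSquare, h z) ^ 2 :=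
    integral_nonneg fun z => sq_nonneg _
  linarith

lemma variance_unitSquare_le {h : ℂ → ℝ} (hc : Continuous h) (b : ℝ) :
    (∫ z in unitSquare, h z ^ 2) - (∫ z in unitSquare, h z) ^ 2
      ≤ ∫ z in unitSquare, (h z - b) ^ 2 := by
  rw [integral_unitSquare_sub_sq hc]
  linarith [sq_nonneg ((∫ z in unitSquare, h z) - b)]

lemma half_add_mem_unitSquare (i : Fin 4) {z : ℂ} (hz : z ∈ unitSquare) :
    ((![0, 1, I, 1 + I] : Fin 4 → ℂ) i + z) / 2 ∈ unitSquare := by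
  obtain ⟨⟨h1, h2⟩, h3, h4⟩ := mem_reProdIm.1 hz
  refine mem_reProdIm.2 ?_
  fin_cases i <;> simp <;> constructor <;> constructor <;> linarith

/-- A dyadic John–Nirenberg inequality: exponential integrability of a continuous function whose
variance over every square is at most one. -/
lemma integral_exp_div_three_le {h : ℂ → ℝ} (hc : Continuous h)
    (hvar : ∀ (c : ℂ) (r : ℝ), 0 < r → ∃ b : ℝ, ∫ z in unitSquare, (h (c + r * z) - b) ^ 2 ≤ 1) :
    ∫ z in unitSquare, Real.exp (h z / 3) ≤ 4 * Real.exp ((∫ z in unitSquare, h z) / 3) := by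
  obtain ⟨δ, hδ, hosc⟩ := Metric.uniformContinuousOn_iff.1
    (isCompact_unitSquare.uniformContinuousOn_of_continuous hc.continuousOn) 1 one_pos
  have hw : ∀ (c : ℂ) (r : ℝ), 0 < r → (∫ z in unitSquare, h (c + r * z) ^ 2)
      - (∫ z in unitSquare, h (c + r * z)) ^ 2 ∈ Icc (0 : ℝ) 1 := by
    intro c r hr
    obtain ⟨b, hb⟩ := hvar c r hr
    exact ⟨sub_nonneg.2 (sq_integral_unitSquare_le (h := fun z => h (c + r * z)) (by fun_prop)),
      (variance_unitSquare_le (h := fun z => h (c + r * z)) (by fun_prop) b).trans hb⟩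
  have main : ∀ (n : ℕ) (c : ℂ) (r : ℝ), 0 < r → 4 * r < 2 ^ n * δ →
      (∀ z ∈ unitSquare, c + r * z ∈ unitSquare) →
      ∫ z in unitSquare, Real.exp (h (c + r * z) / 3)
        ≤ Real.exp (1 / 3) * (Real.exp ((∫ z in unitSquare, h (c + r * z)) / 3)
          * (1 + ((∫ z in unitSquare, h (c + r * z) ^ 2)
              - (∫ z in unitSquare, h (c + r * z)) ^ 2)
            - ((∫ z in unitSquare, h (c + r * z) ^ 2)
              - (∫ z in unitSquare, h (c + r * z)) ^ 2) ^ 2 / 4)) := by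
    intro n
    induction n with
    | zero =>
      intro c r hr hrδ hsub
      obtain ⟨hw0, hw1⟩ := hw c r hr
      have hle : ∀ z ∈ unitSquare, h (c + r * z) ≤ (∫ z in unitSquare, h (c + r * z)) + 1 := by
        intro z hz
        have e : h (c + r * z) - 1 = ∫ _ in unitSquare, (h (c + r * z) - 1) := by simp
        rw [← sub_le_iff_le_add, e]
        refine setIntegral_mono_on (integrable_const _)
          (integrableOn_unitSquare (φ := fun w => h (c + r * w)) (by fun_prop))
          isCompact_unitSquare.measurableSet fun w hw => ?_
        have hd : dist (c + r * z) (c + r * w) < δ := by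
          rw [dist_add_left, dist_eq, ← mul_sub, norm_mul, norm_real, Real.norm_eq_abs,
            abs_of_pos hr]
          have := norm_sub_le z w
          nlinarith [norm_le_two_of_mem_unitSquare hz, norm_le_two_of_mem_unitSquare hw]
        have := hosc _ (hsub z hz) _ (hsub w hw) hd
        rw [Real.dist_eq] at this
        linarith [(abs_lt.1 this).2]
      set m := ∫ z in unitSquare, h (c + r * z)
      set v := (∫ z in unitSquare, h (c + r * z) ^ 2) - m ^ 2
      calc ∫ z in unitSquare, Real.exp (h (c + r * z) / 3)
          ≤ ∫ _ in unitSquare, Real.exp ((m + 1) / 3) := by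
            refine setIntegral_mono_on (integrableOn_unitSquare (by fun_prop))
              (integrable_const _) isCompact_unitSquare.measurableSet fun z hz => ?_
            exact Real.exp_le_exp.2 (by linarith [hle z hz])
        _ = Real.exp (1 / 3) * (Real.exp (m / 3) * 1) := by
            rw [mul_one, ← Real.exp_add]
            simp
            ring
        _ ≤ _ := by
            gcongr
            nlinarith
    | succ n ih =>
      intro c r hr hrδ hsub
      set e : Fin 4 → ℂ := ![0, 1, I, 1 + I] with he
      have hr2 : 0 < r / 2 := by positivity
      have hchild : ∀ i, ∀ z ∈ unitSquare,
          c + (r / 2 : ℝ) * e i + (r / 2 : ℝ) * z ∈ unitSquare := by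
        intro i z hz
        have := hsub _ (half_add_mem_unitSquare i hz)
        convert this using 1
        push_cast
        ring
      have hih := fun i => ih (c + (r / 2 : ℝ) * e i) (r / 2) hr2
        (by rw [pow_succ] at hrδ; linarith) (hchild i)
      rw [integral_unitSquare_split (φ := fun z => Real.exp (h z / 3)) (by fun_prop)]
      refine (div_le_div_of_nonneg_right (Finset.sum_le_sum fun i _ => hih i)
        (by norm_num)).trans ?_
      rw [← Finset.mul_sum, mul_div_assoc]
      refine mul_le_mul_of_nonneg_left ?_ (Real.exp_pos _).le
      exact bellman_four (fun i => hw _ _ hr2) (integral_unitSquare_split hc c r)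
        (integral_unitSquare_split (φ := fun z => h z ^ 2) (by fun_prop) c r) (hw c r hr)
  obtain ⟨n, hn⟩ := pow_unbounded_of_one_lt (4 / δ) one_lt_two
  have h1 := main n 0 1 one_pos (by rw [div_lt_iff₀ hδ] at hn; linarith) (by simp)
  have h2 := hw 0 1 one_pos
  simp only [ofReal_one, one_mul, zero_add] at h1 h2
  refine h1.trans ?_
  set m := ∫ z in unitSquare, h z
  set v := (∫ z in unitSquare, h z ^ 2) - m ^ 2
  have hv0 : 0 ≤ 1 + v - v ^ 2 / 4 := by nlinarith [h2.1, h2.2]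
  have hv : 1 + v - v ^ 2 / 4 ≤ 2 := by nlinarith [h2.1, h2.2]
  have he : Real.exp (1 / 3) ≤ 2 := by
    have := (abs_le.1 (Real.abs_exp_sub_one_sub_id_le (x := 1 / 3) (by norm_num [abs_of_pos]))).2
    linarith
  calc Real.exp (1 / 3) * (Real.exp (m / 3) * (1 + v - v ^ 2 / 4))
      ≤ 2 * (Real.exp (m / 3) * 2) := by
        gcongr
    _ = _ := by ring

/-- The point of the plane with the coordinates of a complex number. -/
def planeVec : ℂ →L[ℝ] V2 := ContinuousLinearMap.pi ![reCLM, imCLM]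

lemma planeVec_apply (z : ℂ) : planeVec z = ![z.re, z.im] := by
  ext i
  fin_cases i <;> simp [planeVec]

lemma setIntegral_box_eq (Φ : V2 → ℝ) :
    ∫ x in box, Φ x = ∫ z in unitSquare, Φ (planeVec z) := by
  have h := volume_preserving_equiv_pi.setIntegral_preimage_emb
    measurableEquivPi.measurableEmbedding Φ box
  have e : measurableEquivPi ⁻¹' box = unitSquare := by
    ext z
    simp [box, unitSquare, mem_reProdIm, Pi.le_def, Fin.forall_fin_two]
    tauto
  rw [← h, e]
  simp only [planeVec_apply, measurableEquivPi_apply]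

lemma PeriodicS.exists_abs_le {v : V2 → ℝ} (hv : PeriodicS v) (hc : Continuous v) :
    ∃ M, ∀ x, |v x| ≤ M := by
  obtain ⟨M, hM⟩ := (isCompact_Icc (a := (0 : V2)) (b := 1)).exists_bound_of_continuousOn
    hc.continuousOn
  refine ⟨M, fun x => ?_⟩
  have h := hv (fun i => Int.fract (x i)) fun i => ⌊x i⌋
  have e : ((fun i => Int.fract (x i)) + fun i => ((⌊x i⌋ : ℤ) : ℝ)) = x := by
    funext i
    simp
  rw [e] at h
  rw [h]
  exact hM _ ⟨fun i => Int.fract_nonneg _, fun i => (Int.fract_lt_one _).le⟩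

lemma continuous_pd {v : V2 → ℝ} (hv : ContDiff ℝ 1 v) (i : Fin 2) : Continuous (pd i v) :=
  (hv.continuous_fderiv one_ne_zero).clm_apply continuous_const

lemma fderiv_eq_pd {v : V2 → ℝ} (x y : V2) :
    fderiv ℝ v x y = y 0 * pd 0 v x + y 1 * pd 1 v x := by
  have e : y = y 0 • (Pi.single 0 1 : V2) + y 1 • (Pi.single 1 1 : V2) := by
    ext i
    fin_cases i <;> simp
  conv_lhs => rw [e]
  simp [pd]

lemma PeriodicS.integral_pd_eq_zero {v : V2 → ℝ} (hv : PeriodicS v) (hc : ContDiff ℝ 1 v)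
    (i : Fin 2) : ∫ z in unitSquare, pd i v (planeVec z) = 0 := by
  have hpc := continuous_pd hc i
  have hline : ∀ x : V2, ∫ t in (0 : ℝ)..1, pd i v (x + t • Pi.single i 1) = 0 := by
    intro x
    have hd : ∀ t : ℝ, HasDerivAt (fun t : ℝ => v (x + t • Pi.single i 1))
        (pd i v (x + t • Pi.single i 1)) t := by
      intro t
      have h1 := ((hc.differentiable one_ne_zero) (x + t • Pi.single i 1)).hasFDerivAt
      have h2 : HasDerivAt (fun t : ℝ => x + t • (Pi.single i 1 : V2)) (Pi.single i 1) t := by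
        simpa using ((hasDerivAt_id t).smul_const (Pi.single i 1 : V2)).const_add x
      exact h1.comp_hasDerivAt t h2
    rw [intervalIntegral.integral_eq_sub_of_hasDerivAt (fun t _ => hd t)
      (Continuous.intervalIntegrable (by fun_prop) _ _)]
    have h := hv x (Pi.single i 1)
    have e : (fun j => ((Pi.single i 1 : Fin 2 → ℤ) j : ℝ)) = Pi.single i 1 := by
      funext j
      by_cases hj : j = i
      · subst hj; simp
      · simp [hj]
    rw [e] at h
    simp [h]
  rw [integral_unitSquare_eq (by fun_prop)]
  obtain rfl | rfl : i = 0 ∨ i = 1 := by omega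
  · rw [intervalIntegral_intervalIntegral_swap]
    · refine intervalIntegral.integral_zero_ae (ae_of_all _ fun t _ => ?_)
      refine Eq.trans ?_ (hline (planeVec (t * I)))
      refine intervalIntegral.integral_congr fun s _ => congrArg (pd 0 v) ?_
      ext j
      fin_cases j <;> simp [planeVec_apply]
    · refine IntegrableOn.mono_set (t := uIcc (0 : ℝ) 1 ×ˢ uIcc (0 : ℝ) 1) ?_
        (prod_mono uIoc_subset_uIcc uIoc_subset_uIcc)
      refine ContinuousOn.integrableOn_compact (isCompact_uIcc.prod isCompact_uIcc)
        (Continuous.continuousOn ?_)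
      simp only [Function.uncurry_def]
      fun_prop
  · refine intervalIntegral.integral_zero_ae (ae_of_all _ fun s _ => ?_)
    refine Eq.trans ?_ (hline (planeVec s))
    refine intervalIntegral.integral_congr fun t _ => congrArg (pd 1 v) ?_
    ext j
    fin_cases j <;> simp [planeVec_apply]

/-- Formally `∂f` for `f = u₁ - i u₂`, when `u` is divergence free. -/
def dolbeault (u : V2 → V2) (z : ℂ) : ℂ :=
  pd 0 (fun y => u y 0) (planeVec z)
    - I * ((pd 0 (fun y => u y 1) (planeVec z) + pd 1 (fun y => u y 0) (planeVec z)) / 2)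

lemma hasFDerivAt_conj_field {u : V2 → V2} (hu : ContDiff ℝ 1 u) (hdiv : ∀ x, div2 u x = 0)
    (z : ℂ) : HasFDerivAt (fun z => (u (planeVec z) 0 : ℂ) - I * u (planeVec z) 1)
      (dolbeault u z • (1 : ℂ →L[ℝ] ℂ)
        + (-(I * (rot2 u (planeVec z) / 2 : ℝ))) • (conjCLE : ℂ →L[ℝ] ℂ)) z := by
  have hui : ∀ i, ContDiff ℝ 1 fun y => u y i := fun i => contDiff_pi.1 hu i
  have hd : ∀ i, HasFDerivAt (fun z => (u (planeVec z) i : ℂ))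
      (ofRealCLM.comp ((fderiv ℝ (fun y => u y i) (planeVec z)).comp planeVec)) z := fun i =>
    ofRealCLM.hasFDerivAt.comp z
      ((((hui i).differentiable one_ne_zero) _).hasFDerivAt.comp z planeVec.hasFDerivAt)
  refine ((hd 0).sub ((hd 1).const_mul I)).congr_fderiv ?_
  ext h
  have hdz := hdiv (planeVec z)
  unfold div2 at hdz
  have hdz' : pd 1 (fun y => u y 1) (planeVec z) = -pd 0 (fun y => u y 0) (planeVec z) := by
    linarith
  have e : ((starRingEnd ℂ) h) = h.re - h.im * I := by
    apply Complex.ext <;> simp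
  simp only [sub_apply, ContinuousLinearMap.comp_apply, fderiv_eq_pd,
    add_apply, smul_apply, one_apply_eq_self,
    ofRealCLM_apply, smul_eq_mul, dolbeault, rot2, planeVec_apply, ContinuousLinearEquiv.coe_coe,
    conjCLE_apply, e] at hdz' ⊢
  rw [hdz']
  apply Complex.ext <;> simp <;> ring

lemma integral_exp_re_mul_le {f F G : ℂ → ℂ} {K M : ℝ} (hFc : Continuous F) (hGc : Continuous G)
    (hf : ∀ z, HasFDerivAt f (F z • (1 : ℂ →L[ℝ] ℂ) + G z • (conjCLE : ℂ →L[ℝ] ℂ)) z)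
    (hM : ∀ z, ‖f z‖ ≤ M) (hK : ∀ z, ‖G z‖ ≤ K) {a : ℝ} (ha : (3 * a) ^ 2 * (oscConst * K ^ 2) ≤ 1)
    {η : ℂ} (hη : ‖η‖ ≤ 1) (hmean : ∫ z in unitSquare, (η * F z).re = 0) :
    ∫ z in unitSquare, Real.exp (a * (η * F z).re) ≤ 4 := by
  have h := integral_exp_div_three_le (h := fun z => 3 * a * (η * F z).re) (by fun_prop) ?_
  · rw [integral_const_mul, hmean] at h
    simp only [mul_zero, zero_div, Real.exp_zero, mul_one] at h
    refine le_trans (le_of_eq ?_) h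
    refine integral_congr_ae (ae_of_all _ fun z => congrArg Real.exp ?_)
    ring
  · intro c r hr
    obtain ⟨b, hb⟩ := exists_integral_unitSquare_sq_le hFc hGc hf hM hK c hr
    refine ⟨3 * a * (η * b).re, ?_⟩
    calc ∫ z in unitSquare, (3 * a * (η * F (c + r * z)).re - 3 * a * (η * b).re) ^ 2
        ≤ ∫ z in unitSquare, (3 * a) ^ 2 * ‖F (c + r * z) - b‖ ^ 2 := by
          refine integral_mono (integrableOn_unitSquare (by fun_prop))
            (integrableOn_unitSquare (by fun_prop)) fun z => ?_
          simp only
          rw [← mul_sub, mul_pow, ← sub_re, ← mul_sub]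
          refine mul_le_mul_of_nonneg_left ?_ (sq_nonneg _)
          rw [← sq_abs]
          refine pow_le_pow_left₀ (abs_nonneg _) ((abs_re_le_norm _).trans ?_) 2
          rw [norm_mul]
          exact mul_le_of_le_one_left (norm_nonneg _) hη
      _ = (3 * a) ^ 2 * ∫ z in unitSquare, ‖F (c + r * z) - b‖ ^ 2 := integral_const_mul _ _
      _ ≤ (3 * a) ^ 2 * (oscConst * K ^ 2) := by gcongr
      _ ≤ 1 := ha

lemma gradV_le {u : V2 → V2} (hdiv : ∀ x, div2 u x = 0) (z : ℂ) :
    gradV u (planeVec z)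
      ≤ 2 * |(dolbeault u z).re| + 2 * |(dolbeault u z).im| + |rot2 u (planeVec z)| := by
  have hdz := hdiv (planeVec z)
  unfold div2 at hdz
  have hdz' : pd 1 (fun y => u y 1) (planeVec z) = -pd 0 (fun y => u y 0) (planeVec z) := by
    linarith
  have hre : (dolbeault u z).re = pd 0 (fun y => u y 0) (planeVec z) := by
    simp [dolbeault]
  have him : (dolbeault u z).im
      = -((pd 0 (fun y => u y 1) (planeVec z) + pd 1 (fun y => u y 0) (planeVec z)) / 2) := by
    simp [dolbeault]
  have e : ∑ i : Fin 2, ∑ j : Fin 2, (pd j (fun y => u y i) (planeVec z)) ^ 2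
      = 2 * |(dolbeault u z).re| ^ 2 + 2 * |(dolbeault u z).im| ^ 2
        + |rot2 u (planeVec z)| ^ 2 / 2 := by
    simp only [sq_abs, Fin.sum_univ_two, hre, him, hdz', rot2]
    ring
  unfold gradV
  rw [e]
  refine Real.sqrt_le_iff.2 ⟨by positivity, ?_⟩
  have h1 := abs_nonneg (dolbeault u z).re
  have h2 := abs_nonneg (dolbeault u z).im
  have h3 := abs_nonneg (rot2 u (planeVec z))
  nlinarith [mul_nonneg h1 h2, mul_nonneg h1 h3, mul_nonneg h2 h3]

lemma exp_gradV_le {u : V2 → V2} (hdiv : ∀ x, div2 u x = 0) {β γ : ℝ} (hβ : 0 < β)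
    (hγ : ∀ x, β * |rot2 u x| ≤ γ) (z : ℂ) :
    Real.exp (β * gradV u (planeVec z))
      ≤ Real.exp γ / 2 * (Real.exp (4 * β * (1 * dolbeault u z).re)
        + Real.exp (4 * β * (-1 * dolbeault u z).re) + Real.exp (4 * β * (I * dolbeault u z).re)
        + Real.exp (4 * β * (-I * dolbeault u z).re)) := by
  have h1 : β * gradV u (planeVec z)
      ≤ γ + 2 * β * |(dolbeault u z).re| + 2 * β * |(dolbeault u z).im| := by
    have := mul_le_mul_of_nonneg_left (gradV_le hdiv z) hβ.le
    linarith [hγ (planeVec z)]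
  have habs : ∀ x : ℝ, Real.exp (4 * β * |x|)
      ≤ Real.exp (4 * β * x) + Real.exp (4 * β * -x) := by
    intro x
    rcases abs_cases x with ⟨h, -⟩ | ⟨h, -⟩ <;> rw [h] <;>
      linarith [Real.exp_pos (4 * β * x), Real.exp_pos (4 * β * -x)]
  have hre := habs (dolbeault u z).re
  have him := habs (dolbeault u z).im
  set p := |(dolbeault u z).re|
  set q := |(dolbeault u z).im|
  have h2 : Real.exp (2 * β * p) * Real.exp (2 * β * q)
      ≤ (Real.exp (4 * β * p) + Real.exp (4 * β * q)) / 2 := by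
    have ep : Real.exp (4 * β * p) = Real.exp (2 * β * p) ^ 2 := by
      rw [← Real.exp_nat_mul]; congr 1; push_cast; ring
    have eq : Real.exp (4 * β * q) = Real.exp (2 * β * q) ^ 2 := by
      rw [← Real.exp_nat_mul]; congr 1; push_cast; ring
    rw [ep, eq]
    linarith [sq_nonneg (Real.exp (2 * β * p) - Real.exp (2 * β * q))]
  calc Real.exp (β * gradV u (planeVec z))
      ≤ Real.exp (γ + 2 * β * p + 2 * β * q) := Real.exp_le_exp.2 h1
    _ = Real.exp γ * (Real.exp (2 * β * p) * Real.exp (2 * β * q)) := by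
        rw [Real.exp_add, Real.exp_add, mul_assoc]
    _ ≤ Real.exp γ * ((Real.exp (4 * β * p) + Real.exp (4 * β * q)) / 2) := by gcongr
    _ = Real.exp γ / 2 * (Real.exp (4 * β * p) + Real.exp (4 * β * q)) := by ring
    _ ≤ _ := by
        refine mul_le_mul_of_nonneg_left ?_ (by positivity)
        simp only [one_mul, neg_mul, neg_re, mul_re, I_re, I_im, zero_mul, zero_sub, neg_neg]
        linarith

/-- **Lemma 2.3 (Trudinger–Moser inequality on `T²`).**
There exist universal constants `γ > 0` and `C_K > 0` such that for every `C¹`,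
`ℤ²`-periodic, divergence-free vector field `u : ℝ² → ℝ²` with vorticity
`ω = rot u`, and every `β > 0` with `β·‖ω‖_{L^∞(T²)} ≤ γ` (i.e. `β·|ω(x)| ≤ γ`
for all `x`), one has `∫_{[0,1]²} exp(β·|∇u(x)|) dx ≤ C_K`. -/
theorem trudinger_moser :
    ∃ γ > (0 : ℝ), ∃ CK > (0 : ℝ),
      ∀ u : V2 → V2, ContDiff ℝ 1 u → PeriodicV u →
        (∀ x, div2 u x = 0) →
        ∀ β > (0 : ℝ), (∀ x, β * |rot2 u x| ≤ γ) →
          ∫ x in box, Real.exp (β * gradV u x) ≤ CK := by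
  have hosc := oscConst_pos
  refine ⟨1 / (6 * (1 + oscConst)), by positivity, 8 * Real.exp (1 / (6 * (1 + oscConst))),
    by positivity, ?_⟩
  set γ := 1 / (6 * (1 + oscConst)) with hγdef
  intro u hu hper hdiv β hβ hγ
  have hui : ∀ i, ContDiff ℝ 1 fun y => u y i := fun i => contDiff_pi.1 hu i
  have hperi : ∀ i, PeriodicS fun y => u y i := fun i x k => congrFun (hper x k) i
  have hpc : ∀ i j, Continuous (pd j fun y => u y i) := fun i j => continuous_pd (hui i) j
  have hFc : Continuous (dolbeault u) := by
    have h00 := hpc 0 0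
    have h01 := hpc 0 1
    have h10 := hpc 1 0
    unfold dolbeault
    fun_prop
  have hrc : Continuous (rot2 u) := (hpc 1 0).sub (hpc 0 1)
  have hGc : Continuous fun z => -(I * (rot2 u (planeVec z) / 2 : ℝ)) := by fun_prop
  obtain ⟨M₀, hM₀⟩ := (hperi 0).exists_abs_le (hui 0).continuous
  obtain ⟨M₁, hM₁⟩ := (hperi 1).exists_abs_le (hui 1).continuous
  have hM : ∀ z, ‖(u (planeVec z) 0 : ℂ) - I * u (planeVec z) 1‖ ≤ M₀ + M₁ := by
    intro z
    refine (norm_sub_le _ _).trans ?_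
    rw [norm_mul, norm_I, one_mul, norm_real, norm_real]
    exact add_le_add (hM₀ _) (hM₁ _)
  have hK : ∀ z, ‖-(I * ((rot2 u (planeVec z) / 2 : ℝ) : ℂ))‖ ≤ γ / (2 * β) := by
    intro z
    rw [norm_neg, norm_mul, norm_I, one_mul, norm_real, Real.norm_eq_abs, abs_div, abs_two,
      le_div_iff₀ (by positivity)]
    linarith [hγ (planeVec z)]
  have ha : (3 * (4 * β)) ^ 2 * (oscConst * (γ / (2 * β)) ^ 2) ≤ 1 := by
    have e : (3 * (4 * β)) ^ 2 * (oscConst * (γ / (2 * β)) ^ 2)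
        = oscConst / (1 + oscConst) ^ 2 := by
      rw [hγdef]
      field_simp
      norm_num
    rw [e, div_le_one (by positivity)]
    nlinarith
  have hint : ∀ i j, IntegrableOn (fun z => pd j (fun y => u y i) (planeVec z)) unitSquare :=
    fun i j => integrableOn_unitSquare ((hpc i j).comp planeVec.continuous)
  have hre : ∫ z in unitSquare, (dolbeault u z).re = 0 := by
    rw [← (hperi 0).integral_pd_eq_zero (hui 0) 0]
    simp [dolbeault]
  have him : ∫ z in unitSquare, (dolbeault u z).im = 0 := by
    have e : (fun z => (dolbeault u z).im) = fun z => -((pd 0 (fun y => u y 1) (planeVec z)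
        + pd 1 (fun y => u y 0) (planeVec z)) / 2) := by
      funext z
      simp [dolbeault]
    rw [e, integral_neg, integral_div, integral_add (hint 1 0) (hint 0 1),
      (hperi 1).integral_pd_eq_zero (hui 1) 0, (hperi 0).integral_pd_eq_zero (hui 0) 1]
    simp
  have hexp : ∀ η : ℂ, ‖η‖ ≤ 1 →
      ∫ z in unitSquare, Real.exp (4 * β * (η * dolbeault u z).re) ≤ 4 := by
    intro η hη
    refine integral_exp_re_mul_le hFc hGc (hasFDerivAt_conj_field hu hdiv) hM hK ha hη ?_
    simp only [mul_re]
    rw [integral_sub (integrableOn_unitSquare (by fun_prop))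
        (integrableOn_unitSquare (by fun_prop)),
      integral_const_mul, integral_const_mul, hre, him]
    simp
  have hei : ∀ η : ℂ, IntegrableOn (fun z => Real.exp (4 * β * (η * dolbeault u z).re))
      unitSquare := fun η => integrableOn_unitSquare (by fun_prop)
  rw [setIntegral_box_eq]
  calc ∫ z in unitSquare, Real.exp (β * gradV u (planeVec z))
      ≤ ∫ z in unitSquare, Real.exp γ / 2 * (Real.exp (4 * β * (1 * dolbeault u z).re)
        + Real.exp (4 * β * (-1 * dolbeault u z).re) + Real.exp (4 * β * (I * dolbeault u z).re)
        + Real.exp (4 * β * (-I * dolbeault u z).re)) :=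
        integral_mono_of_nonneg (ae_of_all _ fun z => (Real.exp_pos _).le)
          (integrableOn_unitSquare (by fun_prop)) (ae_of_all _ fun z => exp_gradV_le hdiv hβ hγ z)
    _ = Real.exp γ / 2 * ((∫ z in unitSquare, Real.exp (4 * β * (1 * dolbeault u z).re))
        + (∫ z in unitSquare, Real.exp (4 * β * (-1 * dolbeault u z).re))
        + (∫ z in unitSquare, Real.exp (4 * β * (I * dolbeault u z).re))
        + ∫ z in unitSquare, Real.exp (4 * β * (-I * dolbeault u z).re)) := by
        rw [integral_const_mul, integral_add (integrableOn_unitSquare (by fun_prop)) (hei _),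
          integral_add (integrableOn_unitSquare (by fun_prop)) (hei _),
          integral_add (hei _) (hei _)]
    _ ≤ Real.exp γ / 2 * (4 + 4 + 4 + 4) := by
        gcongr <;> exact hexp _ (by simp)
    _ = 8 * Real.exp γ := by ring

end
end
end

section
/- Let ν̃ ≥ 0 and let (δ_n)_{n≥0} be a sequence of non-negative real numbers satisfying δ_n ≤ √(δ_{n−1}) + ν̃ for all n ≥ 1. Then for every n ≥ 0, δ_n ≤ δ₀^{2^{−n}} + Σ_{k=0}^{n−1} ν̃^{2^{−k}}. -/
theorem Real.sqrt_add_le_add_sqrt (x y : ℝ) : √(x + y) ≤ √x + √y := by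
  have le_sq_sqrt (z : ℝ) : z ≤ √z ^ 2 := Real.sqrt_le_left (Real.sqrt_nonneg z) |>.mp le_rfl
  refine Real.sqrt_le_iff.mpr ⟨by positivity, ?_⟩
  nlinarith [le_sq_sqrt x, le_sq_sqrt y, mul_nonneg (Real.sqrt_nonneg x) (Real.sqrt_nonneg y)]

theorem Real.sqrt_sum_le_sum_sqrt {ι : Type*} (s : Finset ι) (f : ι → ℝ) :
    √(∑ i ∈ s, f i) ≤ ∑ i ∈ s, √(f i) :=
  Finset.le_sum_of_subadditive _ Real.sqrt_zero.le Real.sqrt_add_le_add_sqrt s f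

theorem Real.sqrt_rpow_half_pow {x : ℝ} (hx : 0 ≤ x) (n : ℕ) :
    √(x ^ ((1 / 2 : ℝ) ^ n)) = x ^ ((1 / 2 : ℝ) ^ (n + 1)) := by
  rw [Real.sqrt_eq_rpow, ← Real.rpow_mul hx, pow_succ]

/-- **Iterated bound for the discrete dynamical system** `δ_n ≤ √(δ_{n−1}) + ν̃`
(Step 4 of the proof of the Main Theorem): for `ν̃ ≥ 0` and non-negative `(δ_n)`,
`δ_n ≤ δ₀^{2^{−n}} + Σ_{k=0}^{n−1} ν̃^{2^{−k}}` for every `n ≥ 0`, where `x^α`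
denotes the real power of a non-negative number. -/
theorem iterated_sqrt_bound (νt : ℝ) (hνt : 0 ≤ νt) (δ : ℕ → ℝ)
    (hδ_nonneg : ∀ n, 0 ≤ δ n)
    (hrec : ∀ n : ℕ, δ (n + 1) ≤ Real.sqrt (δ n) + νt) :
    ∀ n : ℕ, δ n ≤ δ 0 ^ ((1 / 2 : ℝ) ^ n) +
      ∑ k ∈ Finset.range n, νt ^ ((1 / 2 : ℝ) ^ k) := by
  intro n
  induction n with
  | zero => simp
  | succ n ih =>
    calc δ (n + 1) ≤ √(δ n) + νt := hrec n
      _ ≤ √(δ 0 ^ ((1 / 2 : ℝ) ^ n) + ∑ k ∈ Finset.range n, νt ^ ((1 / 2 : ℝ) ^ k)) + νt := by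
        gcongr
      _ ≤ √(δ 0 ^ ((1 / 2 : ℝ) ^ n)) + ∑ k ∈ Finset.range n, √(νt ^ ((1 / 2 : ℝ) ^ k)) + νt := by
        grw [Real.sqrt_add_le_add_sqrt, Real.sqrt_sum_le_sum_sqrt]
      _ = δ 0 ^ ((1 / 2 : ℝ) ^ (n + 1)) +
          ∑ k ∈ Finset.range (n + 1), νt ^ ((1 / 2 : ℝ) ^ k) := by
        simp_rw [Real.sqrt_rpow_half_pow (hδ_nonneg 0), Real.sqrt_rpow_half_pow hνt]
        rw [Finset.sum_range_succ', pow_zero, Real.rpow_one, add_assoc]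
end
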